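/- arXiv:1912.09688 — 2 statements merged into one kernel-verified Lean document; each statement's English description precedes it below -/
import Mathlib

section
/- Let 0 < s ≤ n/2, κ > n − 2s, and let μ ∈ M^κ(𝔹ⁿ). Let ψ(r) = exp(−r²) and for N ≥ 1 define e_N^{it(-Δ)^α}f(x) = (2π)^{-n} ∫_{ℝⁿ} ψ(|ξ|/N) e^{i(x·ξ + t|ξ|^{2α})} f̂(ξ) dξ. Then for every fixed t ∈ ℝ and every f ∈ H^s(ℝⁿ), one has ‖ sup_{1≤N<∞} |e_N^{it(-Δ)^α}f| ‖_{L¹(μ)} ≲ √(C_κ(μ)) ‖f‖_{H^s(ℝⁿ)}, with implicit constant independent of f, μ and t. -/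
open MeasureTheory Metric Set Filter Topology
open scoped ENNReal NNReal RealInnerProductSpace FourierTransform

noncomputable section

/-- Euclidean space `ℝⁿ`. -/
abbrev Eucl (n : ℕ) : Type := EuclideanSpace ℝ (Fin n)

/-- `f ∈ H^s(ℝⁿ)`, stated in terms of the Fourier transform `Ff = f̂`. -/
def MemHs (n : ℕ) (s : ℝ) (Ff : Eucl n → ℂ) : Prop :=
  AEStronglyMeasurable Ff volume ∧
    Integrable (fun ξ : Eucl n => (1 + ‖ξ‖ ^ 2) ^ s * ‖Ff ξ‖ ^ 2)

/-- The square `‖f‖_{H^s}²` of the Sobolev norm, in terms of `Ff = f̂`. -/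
def sobolevNormSq (n : ℕ) (s : ℝ) (Ff : Eucl n → ℂ) : ℝ :=
  ∫ ξ : Eucl n, (1 + ‖ξ‖ ^ 2) ^ s * ‖Ff ξ‖ ^ 2

/-- `C_κ(μ) = sup_{x ∈ ℝⁿ, r > 0} r^{-κ} μ(Bⁿ(x,r))`. -/
def Ckappa (n : ℕ) (κ : ℝ) (μ : Measure (Eucl n)) : ℝ≥0∞ :=
  ⨆ (x : Eucl n) (r : ℝ) (_ : 0 < r), ENNReal.ofReal (r ^ (-κ)) * μ (ball x r)

/-- The regularized operator `e_N^{it(-Δ)^α} f (x)`, with Gaussian cutoff `ψ(r) = exp (-r²)`. -/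
def eN (n : ℕ) (α N : ℝ) (Ff : Eucl n → ℂ) (x : Eucl n) (t : ℝ) : ℂ :=
  (2 * Real.pi) ^ (-(n : ℝ)) •
    ∫ ξ : Eucl n,
      Real.exp (-(‖ξ‖ / N) ^ 2) •
        (Complex.exp (Complex.I * Complex.ofReal (⟪x, ξ⟫ + t * ‖ξ‖ ^ (2 * α))) * Ff ξ)

lemma measure_ball_le_Ckappa {n : ℕ} (κ : ℝ) (μ : Measure (Eucl n)) (x : Eucl n) {r : ℝ}
    (hr : 0 < r) : μ (ball x r) ≤ Ckappa n κ μ * ENNReal.ofReal (r ^ κ) := by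
  have h : ENNReal.ofReal (r ^ (-κ)) * μ (ball x r) ≤ Ckappa n κ μ :=
    le_iSup₂_of_le x r (le_iSup_of_le hr le_rfl)
  calc μ (ball x r)
      = ENNReal.ofReal (r ^ (-κ)) * μ (ball x r) * ENNReal.ofReal (r ^ κ) := by
        rw [mul_right_comm, ← ENNReal.ofReal_mul (by positivity), ← Real.rpow_add hr]
        simp
    _ ≤ _ := by gcongr

/-- A negative power of the distance is dominated by a dyadic sum of indicators of balls. -/
lemma rpow_neg_dist_le_tsum {n : ℕ} {β : ℝ} (hβ : 0 < β) {x y : Eucl n} (hxy : ‖x - y‖ ≤ 2) :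
    ENNReal.ofReal ‖x - y‖ ^ (-β) ≤ ∑' j : ℕ, (ball x (4 * (1 / 2 : ℝ) ^ j)).indicator
      (fun _ => ENNReal.ofReal (((1 / 2 : ℝ) ^ j) ^ (-β))) y := by
  rcases (norm_nonneg (x - y)).eq_or_lt with h0 | h0
  · have hy : y = x := (sub_eq_zero.1 (norm_eq_zero.1 h0.symm)).symm
    subst hy
    have : (⊤ : ℝ≥0∞) ≤ ∑' j : ℕ, (ball y (4 * (1 / 2 : ℝ) ^ j)).indicator
        (fun _ => ENNReal.ofReal (((1 / 2 : ℝ) ^ j) ^ (-β))) y := by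
      rw [← ENNReal.tsum_const_eq_top_of_ne_zero (α := ℕ) one_ne_zero]
      refine ENNReal.tsum_le_tsum fun j => ?_
      rw [indicator_of_mem (mem_ball_self (by positivity)), ENNReal.one_le_ofReal]
      exact Real.one_le_rpow_of_pos_of_le_one_of_nonpos (by positivity)
        (pow_le_one₀ (by norm_num) (by norm_num)) (by linarith)
    exact le_top.trans this
  · obtain ⟨j, hj1, hj2⟩ := exists_nat_pow_near_of_lt_one (x := ‖x - y‖ / 2) (y := (1 / 2 : ℝ))
      (by positivity) (by linarith) (by norm_num) (by norm_num)
    refine le_trans ?_ (ENNReal.le_tsum j)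
    have hp : (0 : ℝ) < (1 / 2) ^ j := by positivity
    rw [pow_succ] at hj1
    rw [indicator_of_mem (by rw [mem_ball, dist_comm, dist_eq_norm]; linarith),
      ENNReal.ofReal_rpow_of_pos h0]
    exact ENNReal.ofReal_le_ofReal
      (Real.rpow_le_rpow_of_nonpos hp (by linarith) (by linarith))

/-- The Riesz potential of order `β < κ` of a `κ`-dimensional measure on the unit ball is bounded
by a multiple of `C_κ(μ)`. -/
lemma exists_lintegral_rpow_neg_dist_le (n : ℕ) {β κ : ℝ} (hβ : 0 < β) (hβκ : β < κ) :
    ∃ C : ℝ≥0∞, C ≠ ⊤ ∧ ∀ μ : Measure (Eucl n), μ (ball (0 : Eucl n) 1)ᶜ = 0 →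
      ∀ x ∈ ball (0 : Eucl n) 1,
        ∫⁻ y, ENNReal.ofReal ‖x - y‖ ^ (-β) ∂μ ≤ C * Ckappa n κ μ := by
  set ρ : ℝ := (1 / 2 : ℝ) ^ (κ - β) with hρ
  have hρ1 : ρ < 1 := Real.rpow_lt_one (by norm_num) (by norm_num) (by linarith)
  refine ⟨ENNReal.ofReal (4 ^ κ) * (1 - ENNReal.ofReal ρ)⁻¹, ?_, fun μ hμ x hx => ?_⟩
  · refine ENNReal.mul_ne_top ENNReal.ofReal_ne_top (ENNReal.inv_ne_top.2 ?_)
    exact (tsub_pos_iff_lt.2 (by simpa using hρ1)).ne'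
  calc ∫⁻ y, ENNReal.ofReal ‖x - y‖ ^ (-β) ∂μ
      ≤ ∫⁻ y, ∑' j : ℕ, (ball x (4 * (1 / 2 : ℝ) ^ j)).indicator
          (fun _ => ENNReal.ofReal (((1 / 2 : ℝ) ^ j) ^ (-β))) y ∂μ := by
        refine lintegral_mono_ae ?_
        have : ∀ᵐ y ∂μ, y ∈ ball (0 : Eucl n) 1 := hμ
        filter_upwards [this] with y hy
        refine rpow_neg_dist_le_tsum hβ ?_
        rw [mem_ball_zero_iff] at hx hy
        linarith [norm_sub_le x y]
    _ = ∑' j : ℕ, ENNReal.ofReal (((1 / 2 : ℝ) ^ j) ^ (-β)) * μ (ball x (4 * (1 / 2 : ℝ) ^ j)) := by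
        rw [lintegral_tsum fun j => (measurable_const.indicator measurableSet_ball).aemeasurable]
        simp_rw [lintegral_indicator_const measurableSet_ball]
    _ ≤ ∑' j : ℕ, ENNReal.ofReal (4 ^ κ) * Ckappa n κ μ * ENNReal.ofReal ρ ^ j := by
        refine ENNReal.tsum_le_tsum fun j => ?_
        have hp : (0 : ℝ) < (1 / 2) ^ j := by positivity
        calc _ ≤ ENNReal.ofReal (((1 / 2 : ℝ) ^ j) ^ (-β)) *
              (Ckappa n κ μ * ENNReal.ofReal ((4 * (1 / 2 : ℝ) ^ j) ^ κ)) := by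
              gcongr
              exact measure_ball_le_Ckappa κ μ x (by positivity)
          _ = _ := by
              have hpow : ((1 / 2 : ℝ) ^ j) ^ (-β) * ((1 / 2 : ℝ) ^ j) ^ κ = ρ ^ j := by
                rw [← Real.rpow_add hp, hρ, ← Real.rpow_natCast, ← Real.rpow_natCast,
                  ← Real.rpow_mul (by norm_num), ← Real.rpow_mul (by norm_num)]
                ring_nf
              rw [← ENNReal.ofReal_pow (by positivity), ← hpow,
                Real.mul_rpow (by norm_num) hp.le, ENNReal.ofReal_mul (by positivity),
                ENNReal.ofReal_mul (by positivity)]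
              ring
    _ = _ := by
        rw [ENNReal.tsum_mul_left, ENNReal.tsum_geometric]
        ring

lemma rpow_mul_exp_neg_le {b y : ℝ} (hb : 0 < b) (hy : 0 ≤ y) :
    y ^ b * Real.exp (-y) ≤ b ^ b := by
  have h : y ^ b ≤ b ^ b * Real.exp y := by
    calc y ^ b ≤ (b * Real.exp (y / b)) ^ b := by
          refine Real.rpow_le_rpow hy ?_ hb.le
          have := Real.add_one_le_exp (y / b)
          calc y = b * (y / b) := by field_simp
            _ ≤ _ := by gcongr; linarith
      _ = _ := by
          rw [Real.mul_rpow hb.le (Real.exp_pos _).le, ← Real.exp_mul]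
          field_simp
  calc _ ≤ b ^ b * Real.exp y * Real.exp (-y) := by gcongr
    _ = _ := by rw [mul_assoc, ← Real.exp_add]; simp

/-- The Gaussian kernel of variance `v ≥ u` is dominated by `d ^ (-2b) u ^ (b - m)`. -/
lemma gaussian_kernel_le {b m u v d : ℝ} (hb : 0 < b) (hbm : b ≤ m) (hu : 0 < u) (huv : u ≤ v)
    (hd : 0 ≤ d) :
    ENNReal.ofReal ((Real.pi / v) ^ m * Real.exp (-d ^ 2 / (4 * v))) ≤
      ENNReal.ofReal (Real.pi ^ m * (b ^ b * 4 ^ b)) * ENNReal.ofReal (u ^ (b - m)) *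
        ENNReal.ofReal d ^ (-(2 * b)) := by
  have hv : 0 < v := hu.trans_le huv
  have hpi := Real.pi_pos
  rcases hd.eq_or_lt with rfl | hd
  · rw [ENNReal.ofReal_zero, ENNReal.zero_rpow_of_neg (by linarith), ENNReal.mul_top]
    · exact le_top
    · exact mul_ne_zero (by simp only [ne_eq, ENNReal.ofReal_eq_zero, not_le]; positivity)
        (by simp only [ne_eq, ENNReal.ofReal_eq_zero, not_le]; positivity)
  rw [ENNReal.ofReal_rpow_of_pos hd, ← ENNReal.ofReal_mul (by positivity),
    ← ENNReal.ofReal_mul (by positivity)]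
  refine ENNReal.ofReal_le_ofReal ?_
  have h := rpow_mul_exp_neg_le hb (y := d ^ 2 / (4 * v)) (by positivity)
  have hdb : (d ^ 2 / (4 * v)) ^ b = d ^ (2 * b) / (4 ^ b * v ^ b) := by
    rw [Real.div_rpow (by positivity) (by positivity), Real.mul_rpow (by norm_num) hv.le,
      ← Real.rpow_natCast, ← Real.rpow_mul hd.le]
    norm_num
  rw [hdb] at h
  have hexp : Real.exp (-d ^ 2 / (4 * v)) ≤ b ^ b * 4 ^ b * v ^ b * d ^ (-(2 * b)) := by
    rw [Real.rpow_neg hd.le, neg_div, ← div_eq_mul_inv, le_div_iff₀ (by positivity)]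
    rw [div_mul_eq_mul_div, div_le_iff₀ (by positivity)] at h
    linarith
  calc _ ≤ (Real.pi / v) ^ m * (b ^ b * 4 ^ b * v ^ b * d ^ (-(2 * b))) := by gcongr
    _ = Real.pi ^ m * (b ^ b * 4 ^ b) * v ^ (b - m) * d ^ (-(2 * b)) := by
      rw [Real.div_rpow hpi.le hv.le, Real.rpow_sub hv]
      ring
    _ ≤ _ := by
      gcongr ?_ * ?_ * ?_
      exact Real.rpow_le_rpow_of_nonpos hu huv (by linarith)

lemma ofReal_rpow_neg_eq_lintegral {s R : ℝ} (hs : 0 < s) (hR : 0 < R) :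
    ENNReal.ofReal (R ^ (-s)) = ENNReal.ofReal (Real.Gamma s)⁻¹ *
      ∫⁻ u in Ioi (0 : ℝ), ENNReal.ofReal (u ^ (s - 1) * Real.exp (-(R * u))) := by
  have hΓ := Real.Gamma_pos_of_pos hs
  have h := Real.integral_rpow_mul_exp_neg_mul_Ioi hs hR
  have hne : ∫ u in Ioi (0 : ℝ), u ^ (s - 1) * Real.exp (-(R * u)) ≠ 0 := by
    rw [h]; positivity
  rw [← ofReal_integral_eq_lintegral_ofReal (not_imp_comm.1 integral_undef hne), h,
    ← ENNReal.ofReal_mul (by positivity), one_div, Real.inv_rpow hR.le, Real.rpow_neg hR.le]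
  · congr 1
    field_simp
  · filter_upwards [ae_restrict_mem measurableSet_Ioi] with u hu
    have : (0 : ℝ) < u := hu
    simp only [Pi.zero_apply]
    positivity

lemma norm_integral_gaussian_mul_char {n : ℕ} {v : ℝ} (hv : 0 < v) (z : Eucl n) :
    ‖∫ ξ : Eucl n, Real.exp (-v * ‖ξ‖ ^ 2) * Complex.exp (Complex.I * (⟪z, ξ⟫ : ℝ))‖ =
      (Real.pi / v) ^ ((n : ℝ) / 2) * Real.exp (-‖z‖ ^ 2 / (4 * v)) := by
  have h := GaussianFourier.integral_cexp_neg_mul_sq_norm_add (V := Eucl n) (b := (v : ℂ))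
    (by simpa using hv) Complex.I z
  have hpi := Real.pi_pos
  have h1 : ∀ ξ : Eucl n, (Real.exp (-v * ‖ξ‖ ^ 2) : ℂ) * Complex.exp (Complex.I * (⟪z, ξ⟫ : ℝ)) =
      Complex.exp (-(v : ℂ) * (‖ξ‖ : ℂ) ^ 2 + Complex.I * (⟪z, ξ⟫ : ℝ)) := by
    intro ξ
    rw [Complex.exp_add]
    push_cast
    rfl
  simp_rw [h1]
  rw [h, finrank_euclideanSpace_fin]
  have h2 : ((Real.pi : ℂ) / v) ^ ((n : ℂ) / 2) * Complex.exp (Complex.I ^ 2 * (‖z‖ : ℂ) ^ 2 / (4 * v))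
      = ((Real.pi / v) ^ ((n : ℝ) / 2) * Real.exp (-‖z‖ ^ 2 / (4 * v)) : ℝ) := by
    push_cast
    rw [Complex.ofReal_cpow (by positivity)]
    simp
  rw [h2, Complex.norm_of_nonneg (by positivity)]

lemma lintegral_iSup_le_of_forall_selection {X : Type*} [MeasurableSpace X] {μ : Measure X}
    {F : ℕ → X → ℝ≥0∞} (hF : ∀ i, Measurable (F i)) {S : ℝ≥0∞}
    (hS : ∀ (c : X → ℕ) (k : ℕ), Measurable c → (∀ x, c x ≤ k) → ∫⁻ x, F (c x) x ∂μ ≤ S) :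
    ∫⁻ x, ⨆ i, F i x ∂μ ≤ S := by
  have hcomp (c : X → ℕ) (hc : Measurable c) : Measurable fun x => F (c x) x :=
    (measurable_from_prod_countable_right (f := fun p : ℕ × X => F p.1 p.2) hF).comp
      (hc.prodMk measurable_id)
  have hsel (k : ℕ) : ∃ c : X → ℕ, Measurable c ∧ (∀ x, c x ≤ k) ∧
      ∀ x, ∀ i ≤ k, F i x ≤ F (c x) x := by
    induction k with
    | zero =>
      refine ⟨fun _ => 0, measurable_const, fun _ => le_rfl, fun x i hi => ?_⟩
      rw [Nat.le_zero.1 hi]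
    | succ k ih =>
      obtain ⟨c, hc, hck, hcF⟩ := ih
      have hms : MeasurableSet {x | F (k + 1) x ≤ F (c x) x} :=
        measurableSet_le (hF _) (hcomp c hc)
      classical
      refine ⟨fun x => if F (k + 1) x ≤ F (c x) x then c x else k + 1,
        Measurable.ite hms hc measurable_const, fun x => ?_, fun x i hi => ?_⟩
      · have := hck x
        beta_reduce
        split_ifs <;> omega
      · rcases Nat.le_succ_iff.1 hi with hi | rfl
        · have := hcF x i hi
          beta_reduce
          split_ifs with h
          · exact this
          · exact this.trans (not_le.1 h).le
        · beta_reduce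
          split_ifs with h
          · exact h
          · exact le_rfl
  choose c hc hck hcF using hsel
  calc ∫⁻ x, ⨆ i, F i x ∂μ ≤ ∫⁻ x, ⨆ k, F (c k x) x ∂μ :=
        lintegral_mono fun x => iSup_le fun i => le_iSup_of_le i (hcF i x i le_rfl)
    _ = ⨆ k, ∫⁻ x, F (c k x) x ∂μ :=
        lintegral_iSup (fun k => hcomp _ (hc k))
          fun k l hkl x => hcF l x _ ((hck k x).trans hkl)
    _ ≤ S := iSup_le fun k => hS _ k (hc k) (hck k)

/-- A `TT*` identity: the Gaussian-weighted `L²` norm of a superposition of damped characters is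
controlled by the Gaussian interaction energy of the measure. -/
lemma lintegral_gaussian_mul_sq_le {n : ℕ} {μ : Measure (Eucl n)} [IsFiniteMeasure μ]
    {w : Eucl n → ℂ} {a : Eucl n → ℝ} (hw : Measurable w) (hw1 : ∀ x, ‖w x‖ ≤ 1)
    (ha : Measurable a) (ha0 : ∀ x, 0 ≤ a x) {u : ℝ} (hu : 0 < u) :
    ∫⁻ ξ : Eucl n, ENNReal.ofReal (Real.exp (-u * ‖ξ‖ ^ 2)) *
        ‖∫ x, w x * (Real.exp (-a x * ‖ξ‖ ^ 2) * Complex.exp (Complex.I * (⟪x, ξ⟫ : ℝ))) ∂μ‖ₑ ^ 2 ≤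
      ∫⁻ p, ENNReal.ofReal ((Real.pi / (u + a p.1 + a p.2)) ^ ((n : ℝ) / 2) *
        Real.exp (-‖p.1 - p.2‖ ^ 2 / (4 * (u + a p.1 + a p.2)))) ∂(μ.prod μ) := by
  set φ : Eucl n → Eucl n → ℂ := fun x ξ =>
    w x * (Real.exp (-a x * ‖ξ‖ ^ 2) * Complex.exp (Complex.I * (⟪x, ξ⟫ : ℝ))) with hφ
  have hφm : Measurable (Function.uncurry φ) := by
    simp only [hφ, Function.uncurry_def]
    fun_prop
  have hφ1 (x ξ) : ‖φ x ξ‖ ≤ 1 := by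
    simp only [hφ, norm_mul, Complex.norm_exp_I_mul_ofReal, mul_one, Complex.norm_real,
      Real.norm_eq_abs, Real.abs_exp]
    refine mul_le_one₀ (hw1 x) (Real.exp_pos _).le (Real.exp_le_one_iff.2 ?_)
    have := mul_nonneg (ha0 x) (sq_nonneg ‖ξ‖)
    linarith
  set G : Eucl n → Eucl n × Eucl n → ℂ := fun ξ p =>
    Real.exp (-u * ‖ξ‖ ^ 2) * (φ p.1 ξ * (starRingEnd ℂ) (φ p.2 ξ)) with hG
  have hgauss : Integrable (fun ξ : Eucl n => Real.exp (-u * ‖ξ‖ ^ 2)) := by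
    have := (GaussianFourier.integrable_cexp_neg_mul_sq_norm_add (V := Eucl n) (b := (u : ℂ))
      (by simpa using hu) 0 0).norm
    refine this.congr (.of_forall fun ξ => ?_)
    simp only [Complex.norm_exp, zero_mul, add_zero]
    norm_cast
  have hGm : Measurable (Function.uncurry G) := by
    have h1 : Measurable fun q : Eucl n × (Eucl n × Eucl n) => φ q.2.1 q.1 :=
      hφm.comp (measurable_snd.fst.prodMk measurable_fst)
    have h2 : Measurable fun q : Eucl n × (Eucl n × Eucl n) => φ q.2.2 q.1 :=
      hφm.comp (measurable_snd.snd.prodMk measurable_fst)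
    have h3 : Measurable fun q : Eucl n × (Eucl n × Eucl n) =>
        (Real.exp (-u * ‖q.1‖ ^ 2) : ℂ) := by fun_prop
    exact h3.mul (h1.mul (Complex.continuous_conj.measurable.comp h2))
  have hGi : Integrable (Function.uncurry G) (volume.prod (μ.prod μ)) := by
    have hb := hgauss.mul_prod (integrable_const (1 : ℝ) : Integrable _ (μ.prod μ))
    refine hb.mono' hGm.aestronglyMeasurable (.of_forall fun q => ?_)
    simp only [Function.uncurry_def, hG, norm_mul, Complex.norm_real, Real.norm_eq_abs,
      Real.abs_exp, RCLike.norm_conj]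
    gcongr
    exact mul_le_one₀ (hφ1 _ _) (norm_nonneg _) (hφ1 _ _)
  have hinner (ξ : Eucl n) : ∫ p, G ξ p ∂(μ.prod μ) =
      (Real.exp (-u * ‖ξ‖ ^ 2) * ‖∫ x, φ x ξ ∂μ‖ ^ 2 : ℝ) := by
    simp only [hG]
    rw [integral_const_mul, integral_prod_mul (fun x => φ x ξ)
      (fun y => (starRingEnd ℂ) (φ y ξ)), integral_conj, Complex.mul_conj, Complex.normSq_eq_norm_sq]
    push_cast
    rfl
  have hout (p : Eucl n × Eucl n) : ‖∫ ξ, G ξ p‖ ≤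
      (Real.pi / (u + a p.1 + a p.2)) ^ ((n : ℝ) / 2) *
        Real.exp (-‖p.1 - p.2‖ ^ 2 / (4 * (u + a p.1 + a p.2))) := by
    have hv : 0 < u + a p.1 + a p.2 := by linarith [ha0 p.1, ha0 p.2]
    have : ∀ ξ, G ξ p = w p.1 * (starRingEnd ℂ) (w p.2) *
        (Real.exp (-(u + a p.1 + a p.2) * ‖ξ‖ ^ 2) *
          Complex.exp (Complex.I * (⟪p.1 - p.2, ξ⟫ : ℝ))) := by
      intro ξ
      simp only [hG, hφ, map_mul, Complex.conj_ofReal, ← Complex.exp_conj, Complex.conj_I,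
        inner_sub_left]
      have e1 : (Real.exp (-(u + a p.1 + a p.2) * ‖ξ‖ ^ 2) : ℂ) = Real.exp (-u * ‖ξ‖ ^ 2) *
          Real.exp (-a p.1 * ‖ξ‖ ^ 2) * Real.exp (-a p.2 * ‖ξ‖ ^ 2) := by
        rw [← Complex.ofReal_mul, ← Complex.ofReal_mul, ← Real.exp_add, ← Real.exp_add]
        ring_nf
      have e2 : Complex.exp (Complex.I * ((⟪p.1, ξ⟫ - ⟪p.2, ξ⟫ : ℝ) : ℂ)) =
          Complex.exp (Complex.I * (⟪p.1, ξ⟫ : ℝ)) * Complex.exp (-Complex.I * (⟪p.2, ξ⟫ : ℝ)) := by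
        rw [← Complex.exp_add]
        push_cast
        ring_nf
      rw [e1, e2]
      ring
    simp_rw [this]
    rw [integral_const_mul, norm_mul, norm_integral_gaussian_mul_char hv, norm_mul,
      RCLike.norm_conj]
    exact mul_le_of_le_one_left (by positivity) (mul_le_one₀ (hw1 _) (norm_nonneg _) (hw1 _))
  have hint : Integrable fun ξ => Real.exp (-u * ‖ξ‖ ^ 2) * ‖∫ x, φ x ξ ∂μ‖ ^ 2 := by
    have := hGi.integral_prod_left
    simp only [Function.uncurry_apply_pair, hinner] at this
    exact_mod_cast this.re
  calc _ = ∫⁻ ξ, ENNReal.ofReal (Real.exp (-u * ‖ξ‖ ^ 2) * ‖∫ x, φ x ξ ∂μ‖ ^ 2) := by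
        refine lintegral_congr fun ξ => ?_
        rw [ENNReal.ofReal_mul (Real.exp_pos _).le, ENNReal.ofReal_pow (norm_nonneg _),
          ofReal_norm]
    _ = ‖∫ p, (∫ ξ, G ξ p) ∂(μ.prod μ)‖ₑ := by
        rw [← ofReal_integral_eq_lintegral_ofReal hint (.of_forall fun ξ => by positivity),
          ← integral_integral_swap hGi]
        simp_rw [hinner]
        rw [integral_complex_ofReal, ← ofReal_norm, Complex.norm_of_nonneg]
        exact integral_nonneg fun ξ => by positivity
    _ ≤ ∫⁻ p, ‖∫ ξ, G ξ p‖ₑ ∂(μ.prod μ) := enorm_integral_le_lintegral_enorm _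
    _ ≤ _ := lintegral_mono fun p => by
        rw [← ofReal_norm]
        exact ENNReal.ofReal_le_ofReal (hout p)

/-- The dual form of the estimate: superpositions of damped characters against a `κ`-dimensional
measure lie in a weighted `L²` space, uniformly in the damping. -/
lemma exists_lintegral_bessel_mul_sq_le (n : ℕ) {s κ : ℝ} (hs₀ : 0 < s) (hs : s ≤ (n : ℝ) / 2)
    (hκ : (n : ℝ) - 2 * s < κ) :
    ∃ K : ℝ≥0∞, K ≠ ⊤ ∧ ∀ μ : Measure (Eucl n), IsProbabilityMeasure μ →
      μ (ball (0 : Eucl n) 1)ᶜ = 0 → ∀ (w : Eucl n → ℂ) (a : Eucl n → ℝ), Measurable w →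
      (∀ x, ‖w x‖ ≤ 1) → Measurable a → (∀ x, 0 ≤ a x) →
      ∫⁻ ξ : Eucl n, ENNReal.ofReal ((1 + ‖ξ‖ ^ 2) ^ (-s)) *
        ‖∫ x, w x * (Real.exp (-a x * ‖ξ‖ ^ 2) * Complex.exp (Complex.I * (⟪x, ξ⟫ : ℝ))) ∂μ‖ₑ ^ 2 ≤
      K * Ckappa n κ μ := by
  obtain ⟨b, hbn, hbs, hb0, hbκ⟩ : ∃ b : ℝ, b ≤ n / 2 ∧ n / 2 < s + b ∧ 0 < b ∧ 2 * b < κ := by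
    refine ⟨min (n / 2) ((n / 2 - s + κ / 2) / 2), min_le_left _ _, ?_, ?_, ?_⟩
    · rw [← sub_lt_iff_lt_add', lt_min_iff]
      constructor <;> linarith
    · rw [lt_min_iff]
      constructor <;> linarith
    · have := min_le_right ((n : ℝ) / 2) ((n / 2 - s + κ / 2) / 2)
      linarith
  obtain ⟨C, hC, hR⟩ := exists_lintegral_rpow_neg_dist_le n (β := 2 * b) (by linarith) hbκ
  set c : ℝ≥0∞ := ENNReal.ofReal (Real.pi ^ ((n : ℝ) / 2) * (b ^ b * 4 ^ b)) with hc
  set J : ℝ≥0∞ := ∫⁻ u in Ioi (0 : ℝ), ENNReal.ofReal (u ^ (s - 1) * Real.exp (-u)) *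
    ENNReal.ofReal (u ^ (b - (n : ℝ) / 2)) with hJ
  have hJtop : J ≠ ⊤ := by
    have hΓ := (Real.GammaIntegral_convergent (s := s + b - n / 2) (by linarith)).lintegral_lt_top
    refine (lt_of_le_of_lt (le_of_eq ?_) hΓ).ne
    refine setLIntegral_congr_fun measurableSet_Ioi fun u hu => ?_
    have hu : (0 : ℝ) < u := hu
    rw [← ENNReal.ofReal_mul (by positivity), mul_right_comm, ← Real.rpow_add hu, mul_comm]
    ring_nf
  refine ⟨ENNReal.ofReal (Real.Gamma s)⁻¹ * (J * (c * C)), by finiteness, ?_⟩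
  intro μ hμp hμ w a hw hw1 ha ha0
  set W : Eucl n → ℂ := fun ξ =>
    ∫ x, w x * (Real.exp (-a x * ‖ξ‖ ^ 2) * Complex.exp (Complex.I * (⟪x, ξ⟫ : ℝ))) ∂μ with hW
  have hWm : Measurable W := by
    have : StronglyMeasurable (Function.uncurry fun (ξ x : Eucl n) =>
        w x * (Real.exp (-a x * ‖ξ‖ ^ 2) * Complex.exp (Complex.I * (⟪x, ξ⟫ : ℝ)))) := by
      refine Measurable.stronglyMeasurable ?_
      simp only [Function.uncurry_def]
      fun_prop
    exact this.integral_prod_right.measurable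
  have henergy (u : ℝ) (hu : 0 < u) :
      ∫⁻ ξ, ENNReal.ofReal (Real.exp (-u * ‖ξ‖ ^ 2)) * ‖W ξ‖ₑ ^ 2 ≤
        c * ENNReal.ofReal (u ^ (b - (n : ℝ) / 2)) * (C * Ckappa n κ μ) := by
    refine (lintegral_gaussian_mul_sq_le hw hw1 ha ha0 hu).trans ?_
    calc _ ≤ ∫⁻ p, c * ENNReal.ofReal (u ^ (b - (n : ℝ) / 2)) *
            ENNReal.ofReal ‖p.1 - p.2‖ ^ (-(2 * b)) ∂(μ.prod μ) :=
          lintegral_mono fun p => gaussian_kernel_le hb0 hbn hu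
            (by linarith [ha0 p.1, ha0 p.2]) (norm_nonneg _)
      _ = c * ENNReal.ofReal (u ^ (b - (n : ℝ) / 2)) *
            ∫⁻ x, ∫⁻ y, ENNReal.ofReal ‖x - y‖ ^ (-(2 * b)) ∂μ ∂μ := by
          rw [lintegral_const_mul _ (by fun_prop), lintegral_prod _ (by fun_prop)]
      _ ≤ c * ENNReal.ofReal (u ^ (b - (n : ℝ) / 2)) * ∫⁻ _, C * Ckappa n κ μ ∂μ := by
          gcongr 1
          refine lintegral_mono_ae ?_
          have : ∀ᵐ x ∂μ, x ∈ ball (0 : Eucl n) 1 := hμ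
          filter_upwards [this] with x hx using hR μ hμ x hx
      _ = _ := by simp
  have hrepr (ξ : Eucl n) : ENNReal.ofReal ((1 + ‖ξ‖ ^ 2) ^ (-s)) * ‖W ξ‖ₑ ^ 2 =
      ENNReal.ofReal (Real.Gamma s)⁻¹ * ∫⁻ u in Ioi (0 : ℝ),
        ENNReal.ofReal (u ^ (s - 1) * Real.exp (-u)) *
          (ENNReal.ofReal (Real.exp (-u * ‖ξ‖ ^ 2)) * ‖W ξ‖ₑ ^ 2) := by
    rw [ofReal_rpow_neg_eq_lintegral hs₀ (by positivity), mul_assoc,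
      ← lintegral_mul_const _ (by fun_prop)]
    congr 1
    refine setLIntegral_congr_fun measurableSet_Ioi fun u hu => ?_
    have hu : (0 : ℝ) < u := hu
    rw [← mul_assoc, ← ENNReal.ofReal_mul (by positivity), mul_assoc (u ^ (s - 1)), ← Real.exp_add]
    ring_nf
  calc ∫⁻ ξ, ENNReal.ofReal ((1 + ‖ξ‖ ^ 2) ^ (-s)) * ‖W ξ‖ₑ ^ 2
      = ENNReal.ofReal (Real.Gamma s)⁻¹ * ∫⁻ u in Ioi (0 : ℝ),
          ENNReal.ofReal (u ^ (s - 1) * Real.exp (-u)) *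
            ∫⁻ ξ, ENNReal.ofReal (Real.exp (-u * ‖ξ‖ ^ 2)) * ‖W ξ‖ₑ ^ 2 := by
        simp_rw [hrepr]
        rw [lintegral_const_mul' _ _ ENNReal.ofReal_ne_top, lintegral_lintegral_swap]
        · simp_rw [lintegral_const_mul' _ _ ENNReal.ofReal_ne_top]
        · refine Measurable.aemeasurable ?_
          simp only [Function.uncurry_def]
          fun_prop
    _ ≤ ENNReal.ofReal (Real.Gamma s)⁻¹ * ∫⁻ u in Ioi (0 : ℝ),
          ENNReal.ofReal (u ^ (s - 1) * Real.exp (-u)) *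
            (c * ENNReal.ofReal (u ^ (b - (n : ℝ) / 2)) * (C * Ckappa n κ μ)) := by
        gcongr 1
        refine setLIntegral_mono' measurableSet_Ioi fun u hu => ?_
        gcongr
        exact henergy u hu
    _ = _ := by
        have : ∀ u : ℝ, ENNReal.ofReal (u ^ (s - 1) * Real.exp (-u)) *
            (c * ENNReal.ofReal (u ^ (b - (n : ℝ) / 2)) * (C * Ckappa n κ μ)) =
            ENNReal.ofReal (u ^ (s - 1) * Real.exp (-u)) * ENNReal.ofReal (u ^ (b - (n : ℝ) / 2)) *
            (c * C * Ckappa n κ μ) := fun u => by ring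
        simp_rw [this]
        rw [lintegral_mul_const _ (by fun_prop)]
        ring

/-- The inverse Fourier integral of `g` with Gaussian damping `exp (-a|ξ|²)`, up to normalisation. -/
def dampedInverse {n : ℕ} (g : Eucl n → ℂ) (a : ℝ) (x : Eucl n) : ℂ :=
  ∫ ξ : Eucl n, Real.exp (-a * ‖ξ‖ ^ 2) * Complex.exp (Complex.I * (⟪x, ξ⟫ : ℝ)) * g ξ

lemma norm_damped_integrand {n : ℕ} (g : Eucl n → ℂ) (a : ℝ) (x ξ : Eucl n) :
    ‖(Real.exp (-a * ‖ξ‖ ^ 2) * Complex.exp (Complex.I * (⟪x, ξ⟫ : ℝ)) * g ξ : ℂ)‖ =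
      Real.exp (-a * ‖ξ‖ ^ 2) * ‖g ξ‖ := by
  simp only [norm_mul, Complex.norm_exp_I_mul_ofReal, mul_one, Complex.norm_real,
    Real.norm_eq_abs, Real.abs_exp]

lemma measurable_dampedInverse {n : ℕ} {g : Eucl n → ℂ} (hg : Measurable g)
    {a : Eucl n → ℝ} (ha : Measurable a) : Measurable fun x => dampedInverse g (a x) x := by
  have : StronglyMeasurable (Function.uncurry fun (x ξ : Eucl n) =>
      (Real.exp (-a x * ‖ξ‖ ^ 2) * Complex.exp (Complex.I * (⟪x, ξ⟫ : ℝ)) * g ξ : ℂ)) := by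
    refine Measurable.stronglyMeasurable ?_
    simp only [Function.uncurry_def]
    fun_prop
  exact this.integral_prod_right.measurable

lemma continuousOn_dampedInverse {n : ℕ} {g : Eucl n → ℂ} (hg : Measurable g)
    (hgi : ∀ δ > 0, Integrable fun ξ : Eucl n => Real.exp (-δ * ‖ξ‖ ^ 2) * ‖g ξ‖) (x : Eucl n) :
    ContinuousOn (fun a => dampedInverse g a x) (Ioi 0) := by
  intro a₀ ha₀
  have ha₀ : 0 < a₀ := ha₀
  refine ContinuousAt.continuousWithinAt ?_
  refine continuousAt_of_dominated (bound := fun ξ => Real.exp (-(a₀ / 2) * ‖ξ‖ ^ 2) * ‖g ξ‖)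
    (.of_forall fun a => Measurable.aestronglyMeasurable (by fun_prop)) ?_
    (hgi _ (by positivity)) (.of_forall fun ξ => by fun_prop)
  filter_upwards [lt_mem_nhds (half_lt_self ha₀)] with a ha
  refine .of_forall fun ξ => ?_
  rw [norm_damped_integrand]
  gcongr

/-- The linearised maximal estimate. -/
lemma lintegral_dampedInverse_le {n : ℕ} {s : ℝ} {μ : Measure (Eucl n)} [IsProbabilityMeasure μ]
    {S : ℝ≥0∞}
    (hS : ∀ (w : Eucl n → ℂ) (a : Eucl n → ℝ), Measurable w →
      (∀ x, ‖w x‖ ≤ 1) → Measurable a → (∀ x, 0 ≤ a x) →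
      ∫⁻ ξ : Eucl n, ENNReal.ofReal ((1 + ‖ξ‖ ^ 2) ^ (-s)) *
        ‖∫ x, w x * (Real.exp (-a x * ‖ξ‖ ^ 2) * Complex.exp (Complex.I * (⟪x, ξ⟫ : ℝ))) ∂μ‖ₑ ^ 2
        ≤ S)
    {g : Eucl n → ℂ} (hg : Measurable g)
    (hgi : ∀ δ > 0, Integrable fun ξ : Eucl n => Real.exp (-δ * ‖ξ‖ ^ 2) * ‖g ξ‖)
    {a : Eucl n → ℝ} (ha : Measurable a) {δ : ℝ} (hδ : 0 < δ) (haδ : ∀ x, δ ≤ a x) :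
    ∫⁻ x, ‖dampedInverse g (a x) x‖ₑ ∂μ ≤
      (∫⁻ ξ : Eucl n, ENNReal.ofReal ((1 + ‖ξ‖ ^ 2) ^ s) * ‖g ξ‖ₑ ^ 2) ^ (1 / 2 : ℝ) *
        S ^ (1 / 2 : ℝ) := by
  set E : Eucl n → ℂ := fun x => dampedInverse g (a x) x with hE
  have hEm : Measurable E := measurable_dampedInverse hg ha
  set w : Eucl n → ℂ := fun x => (starRingEnd ℂ) (E x) / ‖E x‖ with hw
  have hwm : Measurable w := (Complex.continuous_conj.measurable.comp hEm).div (by fun_prop)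
  have hw1 (x) : ‖w x‖ ≤ 1 := by
    simp only [hw, norm_div, RCLike.norm_conj, Complex.norm_real, norm_norm]
    exact div_self_le_one _
  have hwE (x) : w x * E x = (‖E x‖ : ℂ) := by
    simp only [hw]
    rw [div_mul_eq_mul_div, mul_comm, Complex.mul_conj, Complex.normSq_eq_norm_sq]
    by_cases h : ‖E x‖ = 0
    · simp [h]
    · have : (‖E x‖ : ℂ) ≠ 0 := by exact_mod_cast h
      push_cast
      field_simp
  set W : Eucl n → ℂ := fun ξ =>
    ∫ x, w x * (Real.exp (-a x * ‖ξ‖ ^ 2) * Complex.exp (Complex.I * (⟪x, ξ⟫ : ℝ))) ∂μ with hW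
  have hWm : Measurable W := by
    have : StronglyMeasurable (Function.uncurry fun (ξ x : Eucl n) =>
        w x * (Real.exp (-a x * ‖ξ‖ ^ 2) * Complex.exp (Complex.I * (⟪x, ξ⟫ : ℝ)))) := by
      refine Measurable.stronglyMeasurable ?_
      simp only [Function.uncurry_def]
      fun_prop
    exact this.integral_prod_right.measurable
  set G : Eucl n → Eucl n → ℂ := fun x ξ =>
    w x * (Real.exp (-a x * ‖ξ‖ ^ 2) * Complex.exp (Complex.I * (⟪x, ξ⟫ : ℝ)) * g ξ) with hG
  have hGi : Integrable (Function.uncurry G) (μ.prod volume) := by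
    have hb := (integrable_const (1 : ℝ) : Integrable _ μ).mul_prod (hgi δ hδ)
    refine hb.mono' (Measurable.aestronglyMeasurable ?_) (.of_forall fun q => ?_)
    · simp only [hG, Function.uncurry_def]
      fun_prop
    · simp only [Function.uncurry_def, hG]
      rw [norm_mul, norm_damped_integrand]
      gcongr
      · exact hw1 _
      · exact haδ _
  have hGx (x) : ∫ ξ, G x ξ = (‖E x‖ : ℂ) := by
    rw [← hwE]
    exact integral_const_mul _ _
  have hGξ (ξ) : ∫ x, G x ξ ∂μ = g ξ * W ξ := by
    rw [hW, ← integral_const_mul]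
    exact integral_congr_ae (.of_forall fun x => by simp only [hG]; ring)
  have hEi : Integrable E μ := by
    have := hGi.integral_prod_left
    simp only [Function.uncurry_apply_pair, hGx] at this
    refine (integrable_norm_iff hEm.aestronglyMeasurable).1 ?_
    exact_mod_cast this.re
  have hpt (ξ : Eucl n) : ‖g ξ * W ξ‖ₑ =
      (ENNReal.ofReal ((1 + ‖ξ‖ ^ 2) ^ (s / 2)) * ‖g ξ‖ₑ) *
        (ENNReal.ofReal ((1 + ‖ξ‖ ^ 2) ^ (-s / 2)) * ‖W ξ‖ₑ) := by
    rw [enorm_mul, mul_mul_mul_comm, ← ENNReal.ofReal_mul (by positivity),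
      ← Real.rpow_add (by positivity)]
    ring_nf
    simp
  have hsq (r : ℝ) (ξ : Eucl n) (z : ℂ) : (ENNReal.ofReal ((1 + ‖ξ‖ ^ 2) ^ (r / 2)) * ‖z‖ₑ) ^ (2 : ℝ) =
      ENNReal.ofReal ((1 + ‖ξ‖ ^ 2) ^ r) * ‖z‖ₑ ^ 2 := by
    rw [ENNReal.rpow_two, mul_pow, ← ENNReal.ofReal_pow (by positivity), ← Real.rpow_natCast,
      ← Real.rpow_mul (by positivity)]
    norm_num
  calc ∫⁻ x, ‖E x‖ₑ ∂μ = ‖∫ x, (∫ ξ, G x ξ) ∂μ‖ₑ := by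
        simp_rw [hGx]
        rw [← ofReal_integral_norm_eq_lintegral_enorm hEi, integral_complex_ofReal, ← ofReal_norm,
          Complex.norm_of_nonneg]
        exact integral_nonneg fun ξ => by positivity
    _ = ‖∫ ξ, g ξ * W ξ‖ₑ := by
        rw [integral_integral_swap hGi]
        simp_rw [hGξ]
    _ ≤ ∫⁻ ξ, ‖g ξ * W ξ‖ₑ := enorm_integral_le_lintegral_enorm _
    _ ≤ (∫⁻ ξ : Eucl n, (ENNReal.ofReal ((1 + ‖ξ‖ ^ 2) ^ (s / 2)) * ‖g ξ‖ₑ) ^ (2 : ℝ)) ^ (1 / 2 : ℝ) *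
        (∫⁻ ξ : Eucl n, (ENNReal.ofReal ((1 + ‖ξ‖ ^ 2) ^ (-s / 2)) * ‖W ξ‖ₑ) ^ (2 : ℝ)) ^ (1 / 2 : ℝ) := by
        simp_rw [hpt]
        exact ENNReal.lintegral_mul_le_Lp_mul_Lq volume Real.HolderConjugate.two_two
          (by fun_prop) (by fun_prop)
    _ ≤ _ := by
        simp_rw [hsq]
        gcongr
        exact hS w a hwm hw1 ha fun x => hδ.le.trans (haδ x)

lemma integrable_exp_mul_norm_of_memHs {n : ℕ} {s : ℝ} (hs : 0 ≤ s) {Ff : Eucl n → ℂ}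
    (h : MemHs n s Ff) {δ : ℝ} (hδ : 0 < δ) :
    Integrable fun ξ : Eucl n => Real.exp (-δ * ‖ξ‖ ^ 2) * ‖Ff ξ‖ := by
  have hgauss : Integrable (fun ξ : Eucl n => Real.exp (-(2 * δ) * ‖ξ‖ ^ 2)) := by
    have := (GaussianFourier.integrable_cexp_neg_mul_sq_norm_add (V := Eucl n)
      (b := ((2 * δ : ℝ) : ℂ)) (by rw [Complex.ofReal_re]; positivity) 0 0).norm
    refine this.congr (.of_forall fun ξ => ?_)
    simp only [Complex.norm_exp, zero_mul, add_zero]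
    norm_cast
  refine (hgauss.add h.2).mono' ((Continuous.aestronglyMeasurable (by fun_prop)).mul h.1.norm)
    (.of_forall fun ξ => ?_)
  have h1 : (1 : ℝ) ≤ (1 + ‖ξ‖ ^ 2) ^ s := Real.one_le_rpow (by nlinarith [sq_nonneg ‖ξ‖]) hs
  have h2 : Real.exp (-(2 * δ) * ‖ξ‖ ^ 2) = Real.exp (-δ * ‖ξ‖ ^ 2) ^ 2 := by
    rw [← Real.exp_nat_mul]
    ring_nf
  have h3 := mul_le_mul_of_nonneg_right h1 (sq_nonneg ‖Ff ξ‖)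
  rw [Real.norm_of_nonneg (by positivity), Pi.add_apply, h2]
  nlinarith [two_mul_le_add_sq (Real.exp (-δ * ‖ξ‖ ^ 2)) ‖Ff ξ‖,
    mul_nonneg (Real.exp_pos (-δ * ‖ξ‖ ^ 2)).le (norm_nonneg (Ff ξ))]

lemma enorm_eN_eq {n : ℕ} (α N t : ℝ) {Ff G : Eucl n → ℂ} (hG : Ff =ᵐ[volume] G) (x : Eucl n) :
    ENNReal.ofReal ‖eN n α N Ff x t‖ = ENNReal.ofReal ((2 * Real.pi) ^ (-(n : ℝ))) *
      ‖dampedInverse (fun ξ => Complex.exp (Complex.I * ((t * ‖ξ‖ ^ (2 * α) : ℝ) : ℂ)) * G ξ)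
        (N⁻¹ ^ 2) x‖ₑ := by
  have hpi := Real.pi_pos
  have hc : (0 : ℝ) ≤ (2 * Real.pi) ^ (-(n : ℝ)) := by positivity
  rw [eN, norm_smul, Real.norm_of_nonneg hc, ENNReal.ofReal_mul hc, dampedInverse, ← ofReal_norm]
  congr 3
  refine integral_congr_ae ?_
  filter_upwards [hG] with ξ hξ
  rw [hξ, Complex.real_smul, Complex.ofReal_add, mul_add, Complex.exp_add,
    show -(‖ξ‖ / N) ^ 2 = -N⁻¹ ^ 2 * ‖ξ‖ ^ 2 by ring]
  ring

/-- the maximal estimate for the regularized operators `e_N`,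
uniformly in the time `t`, the measure `μ ∈ M^κ(𝔹ⁿ)` and `f ∈ H^s(ℝⁿ)`. -/
theorem statement1 (n : ℕ) (α : ℝ) (hα : 1 / 2 < α) (s κ : ℝ)
    (hs₀ : 0 < s) (hs : s ≤ (n : ℝ) / 2) (hκ : (n : ℝ) - 2 * s < κ) :
    ∃ C > (0 : ℝ), ∀ t : ℝ, ∀ μ : Measure (Eucl n), IsProbabilityMeasure μ →
      μ (ball (0 : Eucl n) 1)ᶜ = 0 → Ckappa n κ μ < ⊤ →
      ∀ Ff : Eucl n → ℂ, MemHs n s Ff →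
        (∫⁻ x, (⨆ (N : ℝ) (_ : 1 ≤ N), ENNReal.ofReal ‖eN n α N Ff x t‖) ∂μ)
          ≤ ENNReal.ofReal C * (Ckappa n κ μ) ^ (1 / 2 : ℝ) *
              ENNReal.ofReal ((sobolevNormSq n s Ff) ^ (1 / 2 : ℝ)) := by
  obtain ⟨K, hK, hdual⟩ := exists_lintegral_bessel_mul_sq_le n hs₀ hs hκ
  have hpi := Real.pi_pos
  set c : ℝ := (2 * Real.pi) ^ (-(n : ℝ)) with hc
  have hc0 : 0 < c := by positivity
  refine ⟨c * ((K ^ (1 / 2 : ℝ)).toReal + 1), by positivity, ?_⟩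
  intro t μ hμp hμ _ Ff hFf
  obtain ⟨G, hGm, hG⟩ := hFf.1
  set g : Eucl n → ℂ := fun ξ =>
    Complex.exp (Complex.I * ((t * ‖ξ‖ ^ (2 * α) : ℝ) : ℂ)) * G ξ with hg
  have hgm : Measurable g := by
    have := hGm.measurable
    fun_prop
  have hgnorm (ξ) : ‖g ξ‖ = ‖G ξ‖ := by
    rw [hg, norm_mul, Complex.norm_exp_I_mul_ofReal, one_mul]
  have hgi (δ : ℝ) (hδ : δ > 0) :
      Integrable fun ξ : Eucl n => Real.exp (-δ * ‖ξ‖ ^ 2) * ‖g ξ‖ := by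
    refine (integrable_exp_mul_norm_of_memHs hs₀.le hFf hδ).congr ?_
    filter_upwards [hG] with ξ hξ
    rw [hgnorm, hξ]
  have hnorm : ∫⁻ ξ : Eucl n, ENNReal.ofReal ((1 + ‖ξ‖ ^ 2) ^ s) * ‖g ξ‖ₑ ^ 2 =
      ENNReal.ofReal (sobolevNormSq n s Ff) := by
    rw [sobolevNormSq, ofReal_integral_eq_lintegral_ofReal hFf.2 (.of_forall fun ξ => by positivity)]
    refine lintegral_congr_ae ?_
    filter_upwards [hG] with ξ hξ
    rw [ENNReal.ofReal_mul (by positivity), ENNReal.ofReal_pow (norm_nonneg _), hξ, ← hgnorm,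
      ofReal_norm]
  set S : ℝ≥0∞ := ENNReal.ofReal (sobolevNormSq n s Ff) ^ (1 / 2 : ℝ) *
    (K * Ckappa n κ μ) ^ (1 / 2 : ℝ) with hS
  set q : ℕ → Ici (1 : ℝ) := TopologicalSpace.denseSeq (Ici (1 : ℝ)) with hq
  have hqpos (i) : 0 < (q i : ℝ) := one_pos.trans_le (q i).2
  have hmax : ∫⁻ x, ⨆ i, ‖dampedInverse g ((q i : ℝ)⁻¹ ^ 2) x‖ₑ ∂μ ≤ S := by
    refine lintegral_iSup_le_of_forall_selection
      (fun i => (measurable_dampedInverse hgm measurable_const).enorm) fun m k hm hmk => ?_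
    obtain ⟨δ, hδ, hδq⟩ : ∃ δ > 0, ∀ i ≤ k, δ ≤ (q i : ℝ)⁻¹ ^ 2 := by
      obtain ⟨j, -, hj⟩ := Finset.exists_min_image (Finset.range (k + 1))
        (fun i => (q i : ℝ)⁻¹ ^ 2) ⟨0, by simp⟩
      refine ⟨_, pow_pos (inv_pos.2 (hqpos j)) 2, fun i hi => hj i (by simp; omega)⟩
    rw [hS, ← hnorm]
    exact lintegral_dampedInverse_le (a := fun x => (q (m x) : ℝ)⁻¹ ^ 2)
      (hdual μ hμp hμ) hgm hgi
      ((measurable_from_nat (f := fun i => (q i : ℝ)⁻¹ ^ 2)).comp hm) hδ fun x => hδq _ (hmk x)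
  have hsup (x : Eucl n) : (⨆ (N : ℝ) (_ : 1 ≤ N), ENNReal.ofReal ‖eN n α N Ff x t‖) ≤
      ENNReal.ofReal c * ⨆ i, ‖dampedInverse g ((q i : ℝ)⁻¹ ^ 2) x‖ₑ := by
    refine iSup₂_le fun N hN => ?_
    rw [enorm_eN_eq α N t hG]
    gcongr
    have hcont : Continuous fun N : Ici (1 : ℝ) => ‖dampedInverse g ((N : ℝ)⁻¹ ^ 2) x‖ₑ := by
      refine Continuous.enorm ((continuousOn_dampedInverse hgm hgi x).comp_continuous ?_ ?_)
      · exact (continuous_subtype_val.inv₀ fun N => (one_pos.trans_le N.2).ne').pow 2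
      · exact fun N => mem_Ioi.2 (pow_pos (inv_pos.2 (one_pos.trans_le (mem_Ici.1 N.2))) 2)
    exact (TopologicalSpace.denseRange_denseSeq (Ici (1 : ℝ))).induction_on
      (p := fun N : Ici (1 : ℝ) => ‖dampedInverse g ((N : ℝ)⁻¹ ^ 2) x‖ₑ ≤
        ⨆ i, ‖dampedInverse g ((q i : ℝ)⁻¹ ^ 2) x‖ₑ) ⟨N, hN⟩
      (isClosed_le hcont continuous_const)
      fun i => le_iSup (fun i => ‖dampedInverse g ((q i : ℝ)⁻¹ ^ 2) x‖ₑ) i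
  have hKfin : K ^ (1 / 2 : ℝ) ≠ ⊤ := ENNReal.rpow_ne_top_of_nonneg (by norm_num) hK
  calc _ ≤ ∫⁻ x, ENNReal.ofReal c * ⨆ i, ‖dampedInverse g ((q i : ℝ)⁻¹ ^ 2) x‖ₑ ∂μ :=
        lintegral_mono hsup
    _ ≤ ENNReal.ofReal c * S := by
        rw [lintegral_const_mul' _ _ ENNReal.ofReal_ne_top]
        gcongr
    _ = ENNReal.ofReal c * K ^ (1 / 2 : ℝ) * (Ckappa n κ μ) ^ (1 / 2 : ℝ) *
          ENNReal.ofReal ((sobolevNormSq n s Ff) ^ (1 / 2 : ℝ)) := by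
        rw [hS, ENNReal.mul_rpow_of_nonneg _ _ (by norm_num), ENNReal.ofReal_rpow_of_nonneg _
          (by norm_num)]
        · ring
        · exact integral_nonneg fun ξ => by positivity
    _ ≤ _ := by
        rw [ENNReal.ofReal_mul hc0.le]
        gcongr
        exact (ENNReal.le_ofReal_iff_toReal_le hKfin (by positivity)).2 (by linarith)
end
end

section
/- Let 0 < s ≤ n/2, κ > n − 2s, and μ ∈ M^κ(𝔹ⁿ). Suppose that for every f ∈ H^s(ℝⁿ) one has ‖ sup_{0<t<1} |e^{it(-Δ)^α}f| ‖_{L¹(μ)} ≲ √(C_κ(μ)) ‖f‖_{H^s(ℝⁿ)}. Let ψ(r) = exp(−r²) and e_N^{it(-Δ)^α}f(x) = (2π)^{-n} ∫_{ℝⁿ} ψ(|ξ|/N) e^{i(x·ξ + t|ξ|^{2α})} f̂(ξ) dξ. Then for every f ∈ H^s(ℝⁿ): ‖ sup_{0<t<1} sup_{N≥1} |e_N^{it(-Δ)^α}f| ‖_{L¹(μ)} ≲ √(C_κ(μ)) ‖f‖_{H^s(ℝⁿ)}. -/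
open MeasureTheory Metric Set Filter Topology
open scoped ENNReal NNReal RealInnerProductSpace FourierTransform

noncomputable section

/-- The fractional Schrödinger evolution `e^{it(-Δ)^α} f (x)`, defined through the
Fourier transform `Ff = f̂` of the initial datum `f`
(in particular `schrodingerOp n α Ff x 0` plays the role of `f x`). -/
def schrodingerOp (n : ℕ) (α : ℝ) (Ff : Eucl n → ℂ) (x : Eucl n) (t : ℝ) : ℂ :=
  (2 * Real.pi) ^ (-(n : ℝ)) •
    ∫ ξ : Eucl n,
      Complex.exp (Complex.I * Complex.ofReal (⟪x, ξ⟫ + t * ‖ξ‖ ^ (2 * α))) * Ff ξ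

theorem integrable_of_norm_le_exp {f : ℝ → ℂ} (hf : Continuous f) {c K : ℝ} (hc : 0 < c)
    (hneg : ∀ v ≤ 0, ‖f v‖ ≤ K * Real.exp (c * v))
    (hpos : ∀ v, 0 ≤ v → ‖f v‖ ≤ K * Real.exp (-c * v)) : Integrable f := by
  rw [← integrableOn_univ, ← Iic_union_Ioi (a := (0 : ℝ))]
  refine IntegrableOn.union ?_ ?_
  · refine Integrable.mono' ((integrableOn_exp_mul_Iic hc 0).const_mul K)
      hf.aestronglyMeasurable ?_
    exact (ae_restrict_iff' measurableSet_Iic).2 (Eventually.of_forall hneg)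
  · refine Integrable.mono' ((integrableOn_exp_mul_Ioi (neg_neg_of_pos hc) 0).const_mul K)
      hf.aestronglyMeasurable ?_
    exact (ae_restrict_iff' measurableSet_Ioi).2
      (Eventually.of_forall fun v hv => hpos v (le_of_lt hv))

/-- A function whose derivatives up to order two are integrable has integrable Fourier
transform. -/
theorem integrable_fourier_of_hasDerivAt {f f' f'' : ℝ → ℂ}
    (hf : ∀ v, HasDerivAt f (f' v) v) (hf' : ∀ v, HasDerivAt f' (f'' v) v)
    (h0 : Integrable f) (h1 : Integrable f') (h2 : Integrable f'') : Integrable (𝓕 f) := by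
  have d0 : deriv f = f' := funext fun v => (hf v).deriv
  have d1 : deriv f' = f'' := funext fun v => (hf' v).deriv
  have e1 : 𝓕 f' = fun x : ℝ => (2 * Real.pi * Complex.I * x) • 𝓕 f x := by
    rw [← d0]
    exact Real.fourier_deriv h0 (fun v => (hf v).differentiableAt) (d0 ▸ h1)
  have e2 : 𝓕 f'' = fun x : ℝ => (2 * Real.pi * Complex.I * x) • 𝓕 f' x := by
    rw [← d1]
    exact Real.fourier_deriv h1 (fun v => (hf' v).differentiableAt) (d1 ▸ h2)
  have hcont : Continuous (𝓕 f) :=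
    VectorFourier.fourierIntegral_continuous Real.continuous_fourierChar
      (by fun_prop) h0
  refine Integrable.mono' (integrable_inv_one_add_sq.const_mul
    ((∫ v, ‖f v‖) + ∫ v, ‖f'' v‖)) hcont.aestronglyMeasurable (Eventually.of_forall fun y => ?_)
  have b0 : ‖𝓕 f y‖ ≤ ∫ v, ‖f v‖ :=
    VectorFourier.norm_fourierIntegral_le_integral_norm _ _ _ _ _
  have b2 : ‖𝓕 f'' y‖ ≤ ∫ v, ‖f'' v‖ :=
    VectorFourier.norm_fourierIntegral_le_integral_norm _ _ _ _ _
  have hn : ‖𝓕 f'' y‖ = (2 * Real.pi) ^ 2 * y ^ 2 * ‖𝓕 f y‖ := by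
    rw [e2, e1]
    simp only [norm_smul, norm_mul, Complex.norm_I, Complex.norm_real, Real.norm_eq_abs,
      abs_of_pos Real.pi_pos, Complex.norm_ofNat]
    rw [← sq_abs y]; ring
  rw [← div_eq_mul_inv, le_div_iff₀ (by positivity)]
  have hpi : 1 ≤ (2 * Real.pi) ^ 2 := by nlinarith [Real.pi_gt_three]
  nlinarith [mul_nonneg (sub_nonneg.2 hpi) (mul_nonneg (sq_nonneg y) (norm_nonneg (𝓕 f y)))]

theorem norm_one_sub_I_mul (z : ℝ) : 1 ≤ ‖1 - Complex.I * (z : ℂ)‖ ∧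
    |z| ≤ ‖1 - Complex.I * (z : ℂ)‖ := by
  constructor
  · simpa using Complex.abs_re_le_norm (1 - Complex.I * (z : ℂ))
  · simpa using Complex.abs_im_le_norm (1 - Complex.I * (z : ℂ))

theorem one_sub_I_mul_ne_zero (z : ℝ) : 1 - Complex.I * (z : ℂ) ≠ 0 :=
  norm_pos_iff.1 (one_pos.trans_le (norm_one_sub_I_mul z).1)

/-- The difference between the Gaussian and a resolvent profile, in logarithmic coordinates. -/
def logProfile (b v : ℝ) : ℂ :=
  Complex.exp (-(Real.exp (2 * v) : ℝ)) - (1 - Complex.I * (Real.exp (b * v) : ℝ))⁻¹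

theorem hasDerivAt_ofReal_exp_mul (b v : ℝ) :
    HasDerivAt (fun v : ℝ => ((Real.exp (b * v) : ℝ) : ℂ)) (b * (Real.exp (b * v) : ℝ)) v := by
  have h : HasDerivAt (fun v : ℝ => Real.exp (b * v)) (Real.exp (b * v) * b) v := by
    simpa using ((hasDerivAt_id v).const_mul b).exp
  convert h.ofReal_comp using 1
  push_cast; ring

theorem hasDerivAt_gauss_log (v : ℝ) :
    HasDerivAt (fun v : ℝ => Complex.exp (-(Real.exp (2 * v) : ℝ)))
      (-2 * (Real.exp (2 * v) : ℝ) * Complex.exp (-(Real.exp (2 * v) : ℝ))) v := by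
  refine (hasDerivAt_ofReal_exp_mul 2 v).fun_neg.cexp.congr_deriv ?_
  push_cast; ring

theorem hasDerivAt_gauss_log' (v : ℝ) :
    HasDerivAt
      (fun v : ℝ => -2 * ((Real.exp (2 * v) : ℝ) : ℂ) * Complex.exp (-(Real.exp (2 * v) : ℝ)))
      ((4 * ((Real.exp (2 * v) : ℝ) : ℂ) ^ 2 - 4 * (Real.exp (2 * v) : ℝ)) *
        Complex.exp (-(Real.exp (2 * v) : ℝ))) v := by
  refine (((hasDerivAt_ofReal_exp_mul 2 v).const_mul (-2 : ℂ)).fun_mul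
    (hasDerivAt_gauss_log v)).congr_deriv ?_
  push_cast; ring

theorem hasDerivAt_resolvent_log (b v : ℝ) :
    HasDerivAt (fun v : ℝ => (1 - Complex.I * (Real.exp (b * v) : ℝ))⁻¹)
      (Complex.I * b * (Real.exp (b * v) : ℝ) *
        ((1 - Complex.I * (Real.exp (b * v) : ℝ)) ^ 2)⁻¹) v := by
  refine ((((hasDerivAt_ofReal_exp_mul b v).const_mul Complex.I).const_sub 1).fun_inv
    (one_sub_I_mul_ne_zero _)).congr_deriv ?_
  rw [div_eq_mul_inv]; ring

theorem hasDerivAt_resolvent_log' (b v : ℝ) :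
    HasDerivAt (fun v : ℝ => Complex.I * b * (Real.exp (b * v) : ℝ) *
        ((1 - Complex.I * (Real.exp (b * v) : ℝ)) ^ 2)⁻¹)
      (Complex.I * b ^ 2 * (Real.exp (b * v) : ℝ) * (1 + Complex.I * (Real.exp (b * v) : ℝ)) *
        ((1 - Complex.I * (Real.exp (b * v) : ℝ)) ^ 3)⁻¹) v := by
  have h1 := (hasDerivAt_ofReal_exp_mul b v).const_mul (Complex.I * b)
  have h2 := ((((hasDerivAt_ofReal_exp_mul b v).const_mul Complex.I).const_sub 1).fun_pow 2).fun_inv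
    (pow_ne_zero 2 (one_sub_I_mul_ne_zero (Real.exp (b * v))))
  refine (h1.fun_mul h2).congr_deriv ?_
  have := one_sub_I_mul_ne_zero (Real.exp (b * v))
  generalize ((Real.exp (b * v) : ℝ) : ℂ) = z at *
  field_simp
  push_cast
  ring

theorem continuous_gauss_log :
    Continuous fun v : ℝ => Complex.exp (-(Real.exp (2 * v) : ℝ)) := by fun_prop

theorem continuous_resolvent_log (b : ℝ) (k : ℕ) :
    Continuous fun v : ℝ => ((1 - Complex.I * (Real.exp (b * v) : ℝ)) ^ k)⁻¹ :=
  Continuous.inv₀ (by fun_prop) fun _ => pow_ne_zero _ (one_sub_I_mul_ne_zero _)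

theorem norm_cexp_neg_ofReal (x : ℝ) : ‖Complex.exp (-(x : ℂ))‖ = Real.exp (-x) := by
  rw [Complex.norm_exp]; simp

theorem pow_mul_exp_neg_le {x : ℝ} (hx : 0 ≤ x) (k : ℕ) : x ^ k * Real.exp (-x) ≤ k.factorial := by
  have h := Real.pow_div_factorial_le_exp x hx k
  rw [div_le_iff₀ (by positivity)] at h
  rw [Real.exp_neg, ← div_eq_mul_inv, div_le_iff₀ (Real.exp_pos x), mul_comm]
  exact h

theorem integrable_gauss_log' : Integrable fun v : ℝ =>
    -2 * ((Real.exp (2 * v) : ℝ) : ℂ) * Complex.exp (-(Real.exp (2 * v) : ℝ)) := by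
  refine integrable_of_norm_le_exp (c := 2) (K := 4) (by fun_prop) two_pos
    (fun v hv => ?_) (fun v hv => ?_) <;>
  simp only [norm_mul, norm_neg, Complex.norm_ofNat, Complex.norm_real, Real.norm_eq_abs,
    Real.abs_exp, norm_cexp_neg_ofReal]
  · have : Real.exp (-Real.exp (2 * v)) ≤ 1 := Real.exp_le_one_iff.2 (by simp [Real.exp_nonneg])
    nlinarith [Real.exp_pos (2 * v)]
  · have h := pow_mul_exp_neg_le (Real.exp_pos (2 * v)).le 2
    rw [neg_mul, Real.exp_neg (2 * v), ← div_eq_mul_inv, le_div_iff₀ (Real.exp_pos _)]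
    norm_num [Nat.factorial] at h
    linarith

theorem integrable_gauss_log'' : Integrable fun v : ℝ =>
    (4 * ((Real.exp (2 * v) : ℝ) : ℂ) ^ 2 - 4 * (Real.exp (2 * v) : ℝ)) *
        Complex.exp (-(Real.exp (2 * v) : ℝ)) := by
  have key (x : ℝ) (hx : 0 ≤ x) : ‖(4 * (x : ℂ) ^ 2 - 4 * (x : ℝ)) * Complex.exp (-(x : ℝ))‖ ≤
      (4 * x ^ 2 + 4 * x) * Real.exp (-x) := by
    rw [norm_mul, norm_cexp_neg_ofReal]
    gcongr
    refine (norm_sub_le _ _).trans (le_of_eq ?_)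
    simp [abs_of_nonneg hx]
  refine integrable_of_norm_le_exp (c := 2) (K := 48) (by fun_prop) two_pos
    (fun v hv => (key _ (Real.exp_pos _).le).trans ?_)
    (fun v hv => (key _ (Real.exp_pos _).le).trans ?_)
  · have h1 : Real.exp (-Real.exp (2 * v)) ≤ 1 := Real.exp_le_one_iff.2 (by simp [Real.exp_nonneg])
    have h2 : Real.exp (2 * v) ≤ 1 := Real.exp_le_one_iff.2 (by linarith)
    have h3 := Real.exp_pos (2 * v)
    have h4 := Real.exp_pos (-Real.exp (2 * v))
    calc _ ≤ (4 * Real.exp (2 * v) ^ 2 + 4 * Real.exp (2 * v)) * 1 := by gcongr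
      _ ≤ _ := by nlinarith
  · have h := pow_mul_exp_neg_le (Real.exp_pos (2 * v)).le 2
    have h' := pow_mul_exp_neg_le (Real.exp_pos (2 * v)).le 3
    rw [neg_mul, Real.exp_neg (2 * v), ← div_eq_mul_inv, le_div_iff₀ (Real.exp_pos _)]
    norm_num [Nat.factorial] at h h'
    nlinarith

theorem integrable_resolvent_log' {b : ℝ} (hb : 0 < b) : Integrable fun v : ℝ =>
    Complex.I * b * (Real.exp (b * v) : ℝ) *
        ((1 - Complex.I * (Real.exp (b * v) : ℝ)) ^ 2)⁻¹ := by
  refine integrable_of_norm_le_exp (c := b) (K := b)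
    (Continuous.mul (by fun_prop) (continuous_resolvent_log b 2)) hb
    (fun v hv => ?_) (fun v hv => ?_) <;>
  · obtain ⟨h1, h2⟩ := norm_one_sub_I_mul (Real.exp (b * v))
    have h3 := Real.exp_pos (b * v)
    rw [abs_of_pos h3] at h2
    simp only [norm_mul, norm_inv, norm_pow, Complex.norm_I, Complex.norm_real, Real.norm_eq_abs,
      Real.abs_exp, abs_of_pos hb, one_mul, neg_mul, Real.exp_neg]
    rw [mul_assoc]
    refine mul_le_mul_of_nonneg_left ?_ hb.le
    rw [← div_eq_mul_inv, div_le_iff₀ (by positivity)]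
    first
    | exact le_mul_of_one_le_right h3.le (one_le_pow₀ h1)
    | rw [inv_mul_eq_div, le_div_iff₀ h3, ← sq]
      gcongr

theorem integrable_resolvent_log'' {b : ℝ} (hb : 0 < b) : Integrable fun v : ℝ =>
    Complex.I * b ^ 2 * (Real.exp (b * v) : ℝ) * (1 + Complex.I * (Real.exp (b * v) : ℝ)) *
        ((1 - Complex.I * (Real.exp (b * v) : ℝ)) ^ 3)⁻¹ := by
  refine integrable_of_norm_le_exp (c := b) (K := b ^ 2)
    (Continuous.mul (by fun_prop) (continuous_resolvent_log b 3)) hb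
    (fun v hv => ?_) (fun v hv => ?_) <;>
  · obtain ⟨h1, h2⟩ := norm_one_sub_I_mul (Real.exp (b * v))
    have h3 := Real.exp_pos (b * v)
    have h4 : ‖1 + Complex.I * (Real.exp (b * v) : ℂ)‖ =
        ‖1 - Complex.I * ((Real.exp (b * v) : ℝ) : ℂ)‖ := by
      rw [← RCLike.norm_conj]
      simp only [map_add, map_one, map_mul, Complex.conj_I, Complex.conj_ofReal, neg_mul,
        sub_eq_add_neg]
    rw [abs_of_pos h3] at h2
    simp only [norm_mul, norm_inv, norm_pow, Complex.norm_I, Complex.norm_real, Real.norm_eq_abs,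
      Real.abs_exp, abs_of_pos hb, one_mul, neg_mul, Real.exp_neg]
    rw [mul_assoc, mul_assoc, h4]
    refine mul_le_mul_of_nonneg_left ?_ (by positivity)
    rw [show ∀ w : ℝ, w * (w ^ 3)⁻¹ = (w ^ 2)⁻¹ from fun w => by
      rcases eq_or_ne w 0 with rfl | hw
      · simp
      · field_simp]
    rw [← div_eq_mul_inv, div_le_iff₀ (by positivity)]
    first
    | exact le_mul_of_one_le_right h3.le (one_le_pow₀ h1)
    | rw [inv_mul_eq_div, le_div_iff₀ h3, ← sq]
      gcongr

theorem integrable_logProfile {b : ℝ} (hb : 0 < b) : Integrable (logProfile b) := by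
  have hc : Continuous (logProfile b) :=
    continuous_gauss_log.sub (by simpa using continuous_resolvent_log b 1)
  refine integrable_of_norm_le_exp (c := min 2 b) (K := 2) hc (lt_min two_pos hb)
    (fun v hv => ?_) (fun v hv => ?_)
  all_goals
    obtain ⟨h1, h2⟩ := norm_one_sub_I_mul (Real.exp (b * v))
    have h3 := Real.exp_pos (b * v)
    have h0 := Real.exp_pos (2 * v)
    rw [abs_of_pos h3] at h2
    have hne := one_sub_I_mul_ne_zero (Real.exp (b * v))
  · have e : logProfile b v = (Complex.exp (-(Real.exp (2 * v) : ℝ)) - 1) +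
        (-Complex.I * (Real.exp (b * v) : ℝ)) * (1 - Complex.I * (Real.exp (b * v) : ℝ))⁻¹ := by
      rw [logProfile]
      linear_combination -(mul_inv_cancel₀ hne)
    have a1 : ‖Complex.exp (-(Real.exp (2 * v) : ℝ)) - 1‖ ≤ Real.exp (2 * v) := by
      rw [← Complex.ofReal_neg, ← Complex.ofReal_exp, ← Complex.ofReal_one, ← Complex.ofReal_sub,
        Complex.norm_real, Real.norm_eq_abs, abs_le]
      constructor
      · linarith [Real.add_one_le_exp (-Real.exp (2 * v))]
      · linarith [Real.exp_le_one_iff.2 (neg_nonpos.2 h0.le)]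
    have a2 : ‖(-Complex.I * (Real.exp (b * v) : ℝ)) *
        (1 - Complex.I * (Real.exp (b * v) : ℝ))⁻¹‖ ≤ Real.exp (b * v) := by
      simp only [norm_mul, norm_inv, norm_neg, Complex.norm_I, Complex.norm_real,
        Real.norm_eq_abs, Real.abs_exp, one_mul]
      exact mul_le_of_le_one_right h3.le (inv_le_one_of_one_le₀ h1)
    have b1 : Real.exp (2 * v) ≤ Real.exp (min 2 b * v) :=
      Real.exp_le_exp.2 (mul_le_mul_of_nonpos_right (min_le_left _ _) hv)
    have b2 : Real.exp (b * v) ≤ Real.exp (min 2 b * v) :=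
      Real.exp_le_exp.2 (mul_le_mul_of_nonpos_right (min_le_right _ _) hv)
    rw [e]
    linarith [norm_add_le (Complex.exp (-(Real.exp (2 * v) : ℝ)) - 1)
      ((-Complex.I * (Real.exp (b * v) : ℝ)) * (1 - Complex.I * (Real.exp (b * v) : ℝ))⁻¹)]
  · have a1 : ‖Complex.exp (-(Real.exp (2 * v) : ℝ))‖ ≤ Real.exp (-(2 * v)) := by
      rw [norm_cexp_neg_ofReal, Real.exp_neg (2 * v), inv_eq_one_div, le_div_iff₀ h0, mul_comm]
      simpa using pow_mul_exp_neg_le h0.le 1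
    have a2 : ‖(1 - Complex.I * (Real.exp (b * v) : ℝ))⁻¹‖ ≤ Real.exp (-(b * v)) := by
      rw [norm_inv, Real.exp_neg]
      exact inv_anti₀ h3 h2
    have b1 : Real.exp (-(2 * v)) ≤ Real.exp (-min 2 b * v) :=
      Real.exp_le_exp.2 (by nlinarith [mul_le_mul_of_nonneg_right (min_le_left 2 b) hv])
    have b2 : Real.exp (-(b * v)) ≤ Real.exp (-min 2 b * v) :=
      Real.exp_le_exp.2 (by nlinarith [mul_le_mul_of_nonneg_right (min_le_right 2 b) hv])
    rw [logProfile]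
    linarith [norm_sub_le (Complex.exp (-(Real.exp (2 * v) : ℝ)))
      (1 - Complex.I * (Real.exp (b * v) : ℝ))⁻¹]

theorem integrable_fourier_logProfile {b : ℝ} (hb : 0 < b) :
    Integrable (𝓕 (logProfile b)) :=
  integrable_fourier_of_hasDerivAt
    (fun v => (hasDerivAt_gauss_log v).sub (hasDerivAt_resolvent_log b v))
    (fun v => (hasDerivAt_gauss_log' v).sub (hasDerivAt_resolvent_log' b v))
    (integrable_logProfile hb)
    (integrable_gauss_log'.sub (integrable_resolvent_log' hb))
    (integrable_gauss_log''.sub (integrable_resolvent_log'' hb))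

theorem logProfile_eq_integral {b : ℝ} (hb : 0 < b) (v : ℝ) :
    logProfile b v =
      ∫ y : ℝ, Complex.exp (Complex.I * ((2 * Real.pi * y * v : ℝ) : ℂ)) * 𝓕 (logProfile b) y := by
  have hc : Continuous (logProfile b) :=
    continuous_gauss_log.sub (by simpa using continuous_resolvent_log b 1)
  have h := congrFun (hc.fourierInv_fourier_eq (integrable_logProfile hb)
    (integrable_fourier_logProfile hb)) v
  rw [← h, Real.fourierInv_eq']
  refine integral_congr_ae (Eventually.of_forall fun y => ?_)
  simp only [smul_eq_mul, RCLike.inner_apply, conj_trivial]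
  congr 2
  push_cast; ring

/-- Decomposition of the Gaussian cutoff into a resolvent and a superposition of imaginary
powers. -/
theorem gauss_eq_resolvent_add_integral {b : ℝ} (hb : 0 < b) {r N : ℝ} (hr : 0 < r) (hN : 0 < N) :
    (Real.exp (-(r / N) ^ 2) : ℂ) = (1 - Complex.I * ((r ^ b / N ^ b : ℝ) : ℂ))⁻¹ +
      ∫ y : ℝ, Complex.exp (Complex.I * ((2 * Real.pi * y * (Real.log r - Real.log N) : ℝ) : ℂ)) *
        𝓕 (logProfile b) y := by
  rw [← logProfile_eq_integral hb, logProfile, ← Real.log_div hr.ne' hN.ne']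
  have h : 0 < r / N := div_pos hr hN
  have e1 : Real.exp (2 * Real.log (r / N)) = (r / N) ^ 2 := by
    rw [mul_comm, Real.exp_mul, Real.exp_log h]; norm_cast
  have e2 : Real.exp (b * Real.log (r / N)) = r ^ b / N ^ b := by
    rw [mul_comm, Real.exp_mul, Real.exp_log h, Real.div_rpow hr.le hN.le]
  rw [e1, e2]
  push_cast; ring

/-- The maximal function `sup_{0<t<1} |e^{it(-Δ)^α} f|`. -/
def schrodingerMax (n : ℕ) (α : ℝ) (F : Eucl n → ℂ) (x : Eucl n) : ℝ≥0∞ :=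
  ⨆ (t : ℝ) (_ : t ∈ Ioo (0 : ℝ) 1), ENNReal.ofReal ‖schrodingerOp n α F x t‖

/-- The multiplication of `F` by the unimodular function `exp (i φ)`. -/
def modulate {n : ℕ} (φ : Eucl n → ℝ) (F : Eucl n → ℂ) (ξ : Eucl n) : ℂ :=
  Complex.exp (Complex.I * (φ ξ : ℂ)) * F ξ

theorem norm_exp_I_mul (a : ℝ) : ‖Complex.exp (Complex.I * (a : ℂ))‖ = 1 := by
  rw [mul_comm]; exact Complex.norm_exp_ofReal_mul_I a

section modulate

variable {n : ℕ} {φ : Eucl n → ℝ} {F : Eucl n → ℂ}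

theorem norm_modulate (ξ : Eucl n) : ‖modulate φ F ξ‖ = ‖F ξ‖ := by
  rw [modulate, norm_mul, norm_exp_I_mul, one_mul]

theorem aestronglyMeasurable_modulate (hφ : Measurable φ)
    (hF : AEStronglyMeasurable F volume) : AEStronglyMeasurable (modulate φ F) volume :=
  AEStronglyMeasurable.mul (by fun_prop) hF

theorem integrable_modulate (hφ : Measurable φ) (hF : Integrable F) :
    Integrable (modulate φ F) :=
  hF.mono (aestronglyMeasurable_modulate hφ hF.1)
    (Eventually.of_forall fun ξ => (norm_modulate ξ).le)

theorem memHs_modulate {s : ℝ} (hφ : Measurable φ) (hF : MemHs n s F) :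
    MemHs n s (modulate φ F) := by
  refine ⟨aestronglyMeasurable_modulate hφ hF.1, ?_⟩
  simpa only [norm_modulate] using hF.2

theorem sobolevNormSq_modulate (s : ℝ) :
    sobolevNormSq n s (modulate φ F) = sobolevNormSq n s F := by
  simp only [sobolevNormSq, norm_modulate]

end modulate

section evolution

variable {n : ℕ} (α : ℝ) {F : Eucl n → ℂ}

theorem schrodingerOp_eq (F : Eucl n → ℂ) (x : Eucl n) (t : ℝ) :
    schrodingerOp n α F x t = (2 * Real.pi) ^ (-(n : ℝ)) •
      ∫ ξ, modulate (fun ξ => ⟪x, ξ⟫ + t * ‖ξ‖ ^ (2 * α)) F ξ := rfl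

theorem eN_eq_schrodingerOp (N : ℝ) (F : Eucl n → ℂ) (x : Eucl n) (t : ℝ) :
    eN n α N F x t =
      schrodingerOp n α (fun ξ => (Real.exp (-(‖ξ‖ / N) ^ 2) : ℂ) * F ξ) x t := by
  simp only [eN, schrodingerOp, Complex.real_smul, Complex.ofReal_exp]
  congr 2; ext ξ; push_cast; ring

theorem schrodingerOp_add {G : Eucl n → ℂ} (hF : Integrable F) (hG : Integrable G)
    (x : Eucl n) (t : ℝ) :
    schrodingerOp n α (fun ξ => F ξ + G ξ) x t =
      schrodingerOp n α F x t + schrodingerOp n α G x t := by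
  rw [schrodingerOp_eq, schrodingerOp_eq, schrodingerOp_eq, ← smul_add,
    ← integral_add (integrable_modulate (by fun_prop) hF) (integrable_modulate (by fun_prop) hG)]
  simp only [modulate, mul_add]

theorem schrodingerOp_const_mul (c : ℂ) (F : Eucl n → ℂ) (x : Eucl n) (t : ℝ) :
    schrodingerOp n α (fun ξ => c * F ξ) x t = c * schrodingerOp n α F x t := by
  simp only [schrodingerOp, mul_left_comm _ c, integral_const_mul, mul_smul_comm]

theorem schrodingerOp_modulate_time (c : ℝ) (F : Eucl n → ℂ) (x : Eucl n) (t : ℝ) :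
    schrodingerOp n α (modulate (fun ξ => c * ‖ξ‖ ^ (2 * α)) F) x t =
      schrodingerOp n α F x (t + c) := by
  simp only [schrodingerOp, modulate, ← mul_assoc, ← Complex.exp_add]
  congr 2; ext ξ; congr 2; push_cast; ring

/-- Joint continuity of a continuously modulated evolution. -/
theorem continuous_schrodingerOp_modulate {Y : Type*} [TopologicalSpace Y]
    [FirstCountableTopology Y] (hF : Integrable F) {φ : Y → Eucl n → ℝ}
    (hφm : ∀ y, Measurable (φ y)) (hφc : ∀ ξ, Continuous fun y => φ y ξ) :
    Continuous fun p : (Y × Eucl n) × ℝ =>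
      schrodingerOp n α (modulate (φ p.1.1) F) p.1.2 p.2 := by
  simp only [schrodingerOp_eq]
  have h : Continuous fun p : (Y × Eucl n) × ℝ =>
      ∫ ξ, modulate (fun ξ => ⟪p.1.2, ξ⟫ + p.2 * ‖ξ‖ ^ (2 * α)) (modulate (φ p.1.1) F) ξ := by
    refine continuous_of_dominated (bound := fun ξ => ‖F ξ‖)
      (fun p => ?_) (fun p => ?_) hF.norm (Eventually.of_forall fun ξ => ?_)
    · exact aestronglyMeasurable_modulate (by fun_prop)
        (aestronglyMeasurable_modulate (hφm _) hF.1)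
    · exact Eventually.of_forall fun ξ => by rw [norm_modulate, norm_modulate]
    · have := hφc ξ
      simp only [modulate]
      fun_prop
  exact h.const_smul ((2 * Real.pi) ^ (-(n : ℝ)) : ℝ)

theorem continuous_schrodingerOp_left (hF : Integrable F) (t : ℝ) :
    Continuous fun x => schrodingerOp n α F x t := by
  have h := continuous_schrodingerOp_modulate (Y := Unit) α hF (φ := fun _ _ => 0)
    (fun _ => measurable_const) (fun _ => continuous_const)
  have e : modulate (fun _ => 0) F = F := by ext ξ; simp [modulate]
  simp only [e] at h
  have hp : Continuous fun x : Eucl n => (((), x), t) := by fun_prop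
  have hc := h.comp hp
  exact hc

theorem measurable_schrodingerMax_modulate {Y : Type*} [TopologicalSpace Y]
    [SecondCountableTopology Y] [MeasurableSpace Y] [BorelSpace Y]
    (hF : Integrable F) {φ : Y → Eucl n → ℝ}
    (hφm : ∀ y, Measurable (φ y)) (hφc : ∀ ξ, Continuous fun y => φ y ξ) :
    Measurable fun p : Y × Eucl n => schrodingerMax n α (modulate (φ p.1) F) p.2 := by
  have hc (t : ℝ) : Continuous fun p : Y × Eucl n =>
      schrodingerOp n α (modulate (φ p.1) F) p.2 t := by
    have hp : Continuous fun p : Y × Eucl n => (p, t) := by fun_prop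
    have h := (continuous_schrodingerOp_modulate α hF hφm hφc).comp hp
    exact h
  simp only [schrodingerMax]
  exact LowerSemicontinuous.measurable (lowerSemicontinuous_biSup fun t _ =>
    (ENNReal.continuous_ofReal.comp (hc t).norm).lowerSemicontinuous)

theorem measurable_schrodingerMax (hF : Integrable F) : Measurable (schrodingerMax n α F) :=
  LowerSemicontinuous.measurable (lowerSemicontinuous_biSup fun t _ =>
    (ENNReal.continuous_ofReal.comp
      (continuous_schrodingerOp_left α hF t).norm).lowerSemicontinuous)

theorem enorm_schrodingerOp_le_max {t : ℝ} (ht : t ∈ Ioo (0 : ℝ) 1) (x : Eucl n) :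
    ‖schrodingerOp n α F x t‖ₑ ≤ schrodingerMax n α F x := by
  rw [← ofReal_norm]
  exact le_iSup₂ (f := fun (t : ℝ) (_ : t ∈ Ioo (0 : ℝ) 1) =>
    ENNReal.ofReal ‖schrodingerOp n α F x t‖) t ht

/-- If a Fourier multiplier is a superposition of unimodular multipliers, the corresponding
evolution is bounded by the superposition of the modulated evolutions. -/
theorem enorm_schrodingerOp_superposition_le {ν : Measure ℝ} [SFinite ν] {w : ℝ → ℂ}
    (hw : Integrable w ν) {φ : ℝ → Eucl n → ℝ} (hφ : Measurable (Function.uncurry φ))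
    (hF : Integrable F) {m : Eucl n → ℂ}
    (hm : ∀ᵐ ξ, m ξ = ∫ y, Complex.exp (Complex.I * (φ y ξ : ℂ)) * w y ∂ν)
    (x : Eucl n) (t : ℝ) :
    ‖schrodingerOp n α (fun ξ => m ξ * F ξ) x t‖ₑ ≤
      ∫⁻ y, ‖w y‖ₑ * ‖schrodingerOp n α (modulate (φ y) F) x t‖ₑ ∂ν := by
  set θ : Eucl n → ℝ := fun ξ => ⟪x, ξ⟫ + t * ‖ξ‖ ^ (2 * α) with hθ
  have hθm : Measurable θ := by fun_prop
  have key : schrodingerOp n α (fun ξ => m ξ * F ξ) x t =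
      ∫ y, w y * schrodingerOp n α (modulate (φ y) F) x t ∂ν := by
    simp only [schrodingerOp_eq, mul_smul_comm]
    rw [integral_smul]
    congr 1
    have h1 : ∫ ξ, modulate θ (fun ξ => m ξ * F ξ) ξ =
        ∫ ξ, ∫ y, w y * modulate θ (modulate (φ y) F) ξ ∂ν := by
      refine integral_congr_ae (hm.mono fun ξ hξ => ?_)
      simp only [modulate]
      rw [hξ, ← integral_mul_const, ← integral_const_mul]
      congr 1; ext y; ring
    have h2 : Integrable (Function.uncurry fun (ξ : Eucl n) (y : ℝ) =>
        w y * modulate θ (modulate (φ y) F) ξ) (volume.prod ν) := by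
      have h := hF.mul_prod hw
      have e : (Function.uncurry fun (ξ : Eucl n) (y : ℝ) =>
          w y * modulate θ (modulate (φ y) F) ξ) = fun p : Eucl n × ℝ =>
          (Complex.exp (Complex.I * (θ p.1 : ℂ)) *
            Complex.exp (Complex.I * ((Function.uncurry φ p.swap : ℝ) : ℂ))) * (F p.1 * w p.2) := by
        ext p
        simp only [Function.uncurry, modulate, Prod.fst_swap, Prod.snd_swap]; ring
      rw [e]
      refine h.mono (AEStronglyMeasurable.mul ?_ h.1) (Eventually.of_forall fun p => ?_)
      · have := hφ.comp measurable_swap (α := Eucl n × ℝ)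
        exact Measurable.aestronglyMeasurable (by fun_prop)
      · rw [norm_mul, norm_mul, norm_exp_I_mul, norm_exp_I_mul, one_mul, one_mul]
    rw [h1, integral_integral_swap h2]
    congr 1; ext y
    rw [integral_const_mul]
  rw [key]
  refine (enorm_integral_le_lintegral_enorm _).trans (le_of_eq ?_)
  simp only [enorm_mul]

/-- A weighted sum of the maximal functions over time intervals covering the half line. -/
def schrodingerLongMax (n : ℕ) (α : ℝ) (F : Eucl n → ℂ) (x : Eucl n) : ℝ≥0∞ :=
  ∑' j : ℕ, ENNReal.ofReal (Real.exp (-(j / 4 : ℝ))) *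
    schrodingerMax n α (modulate (fun ξ => (j / 2 : ℝ) * ‖ξ‖ ^ (2 * α)) F) x

theorem measurable_schrodingerLongMax (hF : Integrable F) :
    Measurable (schrodingerLongMax n α F) :=
  Measurable.tsum fun _ => (measurable_schrodingerMax α
    (integrable_modulate (by fun_prop) hF)).const_mul _

theorem enorm_schrodingerOp_le_longMax {t : ℝ} (ht : 0 < t) (x : Eucl n) :
    ‖schrodingerOp n α F x t‖ₑ ≤
      ENNReal.ofReal (Real.exp (t / 2)) * schrodingerLongMax n α F x := by
  obtain ⟨j, hj⟩ : ∃ j : ℕ, ⌈2 * t⌉₊ = j + 1 :=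
    Nat.exists_eq_succ_of_ne_zero (Nat.ceil_pos.2 (by linarith)).ne'
  have h1 : (j : ℝ) < 2 * t := Nat.lt_ceil.1 (by omega)
  have h2 : 2 * t ≤ j + 1 := by exact_mod_cast hj ▸ Nat.le_ceil (2 * t)
  have h3 : ‖schrodingerOp n α F x t‖ₑ ≤
      schrodingerMax n α (modulate (fun ξ => (j / 2 : ℝ) * ‖ξ‖ ^ (2 * α)) F) x := by
    have := enorm_schrodingerOp_le_max α (t := t - j / 2) ⟨by linarith, by linarith⟩ x
      (F := modulate (fun ξ => (j / 2 : ℝ) * ‖ξ‖ ^ (2 * α)) F)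
    rwa [schrodingerOp_modulate_time, sub_add_cancel] at this
  refine h3.trans ?_
  calc _ = ENNReal.ofReal (Real.exp (j / 4)) * (ENNReal.ofReal (Real.exp (-(j / 4 : ℝ))) *
        schrodingerMax n α (modulate (fun ξ => (j / 2 : ℝ) * ‖ξ‖ ^ (2 * α)) F) x) := by
        rw [← mul_assoc, ← ENNReal.ofReal_mul (Real.exp_nonneg _), ← Real.exp_add]
        simp
    _ ≤ _ := by
        refine mul_le_mul' (ENNReal.ofReal_le_ofReal (Real.exp_le_exp.2 (by linarith))) ?_
        exact ENNReal.le_tsum (f := fun j : ℕ => ENNReal.ofReal (Real.exp (-(j / 4 : ℝ))) *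
          schrodingerMax n α (modulate (fun ξ => (j / 2 : ℝ) * ‖ξ‖ ^ (2 * α)) F) x) j

theorem resolvent_eq_integral (a : ℝ) :
    (1 - Complex.I * (a : ℂ))⁻¹ =
      ∫ σ in Ioi (0 : ℝ), Complex.exp (Complex.I * ((σ * a : ℝ) : ℂ)) * (Real.exp (-σ) : ℂ) := by
  have h := integral_exp_mul_complex_Ioi (a := -(1 - Complex.I * (a : ℂ))) (by simp) 0
  rw [Complex.ofReal_zero, mul_zero, Complex.exp_zero, neg_div_neg_eq, one_div] at h
  rw [← h]
  congr 1; ext σ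
  rw [Complex.ofReal_exp, ← Complex.exp_add]
  congr 1; push_cast; ring

theorem enorm_schrodingerOp_resolvent_le (hF : Integrable F) {M : ℝ} (hM : 1 ≤ M) {t : ℝ}
    (ht : t ∈ Ioo (0 : ℝ) 1) (x : Eucl n) :
    ‖schrodingerOp n α (fun ξ => (1 - Complex.I * ((‖ξ‖ ^ (2 * α) / M : ℝ) : ℂ))⁻¹ * F ξ) x t‖ₑ ≤
      (∫⁻ σ in Ioi (0 : ℝ), ENNReal.ofReal (Real.exp (1 / 2) * Real.exp (-(1 / 2) * σ))) *
        schrodingerLongMax n α F x := by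
  have hw : Integrable (fun σ : ℝ => (Real.exp (-σ) : ℂ)) (volume.restrict (Ioi 0)) := by
    have := (integrableOn_exp_mul_Ioi (neg_one_lt_zero (R := ℝ)) 0).ofReal (𝕜 := ℂ)
    simpa using this
  refine (enorm_schrodingerOp_superposition_le α hw
    (φ := fun σ ξ => σ * (‖ξ‖ ^ (2 * α) / M)) (by unfold Function.uncurry; fun_prop) hF
    (Eventually.of_forall fun ξ => resolvent_eq_integral _) x t).trans ?_
  rw [← lintegral_mul_const _ (by fun_prop)]
  refine setLIntegral_mono' measurableSet_Ioi fun σ (hσ : 0 < σ) => ?_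
  have e : (fun ξ : Eucl n => σ * (‖ξ‖ ^ (2 * α) / M)) = fun ξ => σ / M * ‖ξ‖ ^ (2 * α) := by
    ext ξ; ring
  have hσM : σ / M ≤ σ := div_le_self hσ.le hM
  have hpos : 0 < t + σ / M := by have := ht.1; positivity
  rw [e, schrodingerOp_modulate_time, ← ofReal_norm, Complex.norm_real, Real.norm_eq_abs,
    Real.abs_exp]
  refine (mul_le_mul_right (enorm_schrodingerOp_le_longMax α hpos x) _).trans ?_
  rw [← mul_assoc, ← ENNReal.ofReal_mul (Real.exp_nonneg _), ← Real.exp_add, ← Real.exp_add]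
  refine mul_le_mul' (ENNReal.ofReal_le_ofReal (Real.exp_le_exp.2 ?_)) le_rfl
  linarith [ht.2]

/-- The superposition of the maximal functions of the imaginary powers of the Laplacian. -/
def schrodingerImagMax (n : ℕ) (α : ℝ) (w : ℝ → ℂ) (F : Eucl n → ℂ) (x : Eucl n) : ℝ≥0∞ :=
  ∫⁻ y, ‖w y‖ₑ * schrodingerMax n α (modulate (fun ξ => 2 * Real.pi * y * Real.log ‖ξ‖) F) x

theorem enorm_schrodingerOp_imag_le (hF : Integrable F) {w : ℝ → ℂ} (hw : Integrable w)
    {m : Eucl n → ℂ} {ℓ : ℝ}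
    (hm : ∀ᵐ ξ, m ξ = ∫ y : ℝ, Complex.exp (Complex.I *
      ((2 * Real.pi * y * (Real.log ‖ξ‖ - ℓ) : ℝ) : ℂ)) * w y)
    {t : ℝ} (ht : t ∈ Ioo (0 : ℝ) 1) (x : Eucl n) :
    ‖schrodingerOp n α (fun ξ => m ξ * F ξ) x t‖ₑ ≤ schrodingerImagMax n α w F x := by
  refine (enorm_schrodingerOp_superposition_le α hw
    (φ := fun y ξ => 2 * Real.pi * y * (Real.log ‖ξ‖ - ℓ))
    (by unfold Function.uncurry; fun_prop) hF hm x t).trans ?_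
  refine lintegral_mono fun y => mul_le_mul_right ?_ _
  have e : modulate (fun ξ => 2 * Real.pi * y * (Real.log ‖ξ‖ - ℓ)) F =
      fun ξ => Complex.exp (Complex.I * ((-(2 * Real.pi * y * ℓ) : ℝ) : ℂ)) *
        modulate (fun ξ => 2 * Real.pi * y * Real.log ‖ξ‖) F ξ := by
    ext ξ
    simp only [modulate]
    rw [← mul_assoc, ← Complex.exp_add]
    congr 2; push_cast; ring
  rw [e, schrodingerOp_const_mul, enorm_mul, ← ofReal_norm, norm_exp_I_mul, ENNReal.ofReal_one,
    one_mul]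
  exact enorm_schrodingerOp_le_max α ht x

/-- Pointwise domination of the regularized evolutions, uniformly in the cutoff parameter. -/
theorem enorm_eN_le [Nontrivial (Eucl n)] (hα : 0 < α) (hF : Integrable F) {N : ℝ} (hN : 1 ≤ N)
    {t : ℝ} (ht : t ∈ Ioo (0 : ℝ) 1) (x : Eucl n) :
    ‖eN n α N F x t‖ₑ ≤
      (∫⁻ σ in Ioi (0 : ℝ), ENNReal.ofReal (Real.exp (1 / 2) * Real.exp (-(1 / 2) * σ))) *
        schrodingerLongMax n α F x + schrodingerImagMax n α (𝓕 (logProfile (2 * α))) F x := by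
  have hb : 0 < 2 * α := by linarith
  have hM : 1 ≤ N ^ (2 * α) := Real.one_le_rpow hN hb.le
  set m₁ : Eucl n → ℂ := fun ξ => (1 - Complex.I * ((‖ξ‖ ^ (2 * α) / N ^ (2 * α) : ℝ) : ℂ))⁻¹
    with hm₁
  set m₂ : Eucl n → ℂ := fun ξ => (Real.exp (-(‖ξ‖ / N) ^ 2) : ℂ) - m₁ ξ with hm₂
  have n₁ (ξ : Eucl n) : ‖m₁ ξ‖ ≤ 1 := by
    rw [hm₁, norm_inv]
    exact inv_le_one_of_one_le₀ (norm_one_sub_I_mul _).1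
  have n₂ (ξ : Eucl n) : ‖m₂ ξ‖ ≤ 2 := by
    have : ‖(Real.exp (-(‖ξ‖ / N) ^ 2) : ℂ)‖ ≤ 1 := by
      rw [Complex.norm_real, Real.norm_eq_abs, Real.abs_exp]
      exact Real.exp_le_one_iff.2 (neg_nonpos.2 (sq_nonneg _))
    linarith [norm_sub_le (Real.exp (-(‖ξ‖ / N) ^ 2) : ℂ) (m₁ ξ), n₁ ξ]
  have meas₁ : Measurable m₁ := by fun_prop
  have meas₂ : Measurable m₂ := by fun_prop
  have i₁ : Integrable fun ξ => m₁ ξ * F ξ :=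
    hF.bdd_mul meas₁.aestronglyMeasurable (Eventually.of_forall n₁)
  have i₂ : Integrable fun ξ => m₂ ξ * F ξ :=
    hF.bdd_mul meas₂.aestronglyMeasurable (Eventually.of_forall n₂)
  have e : (fun ξ => (Real.exp (-(‖ξ‖ / N) ^ 2) : ℂ) * F ξ) =
      fun ξ => m₁ ξ * F ξ + m₂ ξ * F ξ := by
    ext ξ; simp only [hm₂]; ring
  rw [eN_eq_schrodingerOp, e, schrodingerOp_add α i₁ i₂]
  refine (enorm_add_le _ _).trans (add_le_add
    (enorm_schrodingerOp_resolvent_le α hF hM ht x)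
    (enorm_schrodingerOp_imag_le α hF (integrable_fourier_logProfile hb) (ℓ := Real.log N)
      ?_ ht x))
  filter_upwards [Measure.ae_ne volume (0 : Eucl n)] with ξ hξ
  rw [hm₂]
  exact sub_eq_iff_eq_add'.2
    (gauss_eq_resolvent_add_integral hb (norm_pos_iff.2 hξ) (zero_lt_one.trans_le hN))

variable {μ : Measure (Eucl n)} {A : ℝ≥0∞}

theorem lintegral_schrodingerLongMax_le (hF : Integrable F)
    (h : ∀ φ : Eucl n → ℝ, Measurable φ → ∫⁻ x, schrodingerMax n α (modulate φ F) x ∂μ ≤ A) :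
    ∫⁻ x, schrodingerLongMax n α F x ∂μ ≤
      (∑' j : ℕ, ENNReal.ofReal (Real.exp (-(j / 4 : ℝ)))) * A := by
  have hm (j : ℕ) := measurable_schrodingerMax α (integrable_modulate
    (φ := fun ξ => (j / 2 : ℝ) * ‖ξ‖ ^ (2 * α)) (by fun_prop) hF)
  simp only [schrodingerLongMax]
  rw [lintegral_tsum fun j => ((hm j).const_mul _).aemeasurable, ← ENNReal.tsum_mul_right]
  refine ENNReal.tsum_le_tsum fun j => ?_
  rw [lintegral_const_mul _ (hm j)]
  exact mul_le_mul_right (h _ (by fun_prop)) _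

theorem lintegral_schrodingerImagMax_le [SFinite μ] (hF : Integrable F) {w : ℝ → ℂ}
    (hw : Integrable w)
    (h : ∀ φ : Eucl n → ℝ, Measurable φ → ∫⁻ x, schrodingerMax n α (modulate φ F) x ∂μ ≤ A) :
    ∫⁻ x, schrodingerImagMax n α w F x ∂μ ≤ (∫⁻ y, ‖w y‖ₑ) * A := by
  have hm := measurable_schrodingerMax_modulate α hF
    (φ := fun (y : ℝ) ξ => 2 * Real.pi * y * Real.log ‖ξ‖) (by fun_prop) (by fun_prop)
  simp only [schrodingerImagMax]
  rw [lintegral_lintegral_swap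
    ((hw.1.enorm.comp_snd).mul (hm.comp measurable_swap).aemeasurable),
    ← lintegral_mul_const'' _ hw.1.enorm]
  refine lintegral_mono fun y => ?_
  rw [lintegral_const_mul _ (measurable_schrodingerMax α (integrable_modulate (by fun_prop) hF))]
  exact mul_le_mul_right (h _ (by fun_prop)) _

theorem tsum_ofReal_exp_neg_lt_top :
    ∑' j : ℕ, ENNReal.ofReal (Real.exp (-(j / 4 : ℝ))) < ⊤ := by
  have h : Summable fun j : ℕ => Real.exp (-(j / 4 : ℝ)) := by
    have := Real.summable_exp_nat_mul_iff.2 (show (-(1 / 4) : ℝ) < 0 by norm_num)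
    refine this.congr fun j => ?_
    congr 1; ring
  rw [← ENNReal.ofReal_tsum_of_nonneg (fun _ => Real.exp_nonneg _) h]
  exact ENNReal.ofReal_lt_top

/-- The constant in the comparison of the regularized and unregularized maximal functions. -/
def cutoffConst (α : ℝ) : ℝ≥0∞ :=
  (∫⁻ σ in Ioi (0 : ℝ), ENNReal.ofReal (Real.exp (1 / 2) * Real.exp (-(1 / 2) * σ))) *
    (∑' j : ℕ, ENNReal.ofReal (Real.exp (-(j / 4 : ℝ)))) +
    ∫⁻ y, ‖𝓕 (logProfile (2 * α)) y‖ₑ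

theorem cutoffConst_lt_top (hα : 0 < α) : cutoffConst α < ⊤ := by
  refine ENNReal.add_lt_top.2 ⟨ENNReal.mul_lt_top ?_ tsum_ofReal_exp_neg_lt_top,
    (integrable_fourier_logProfile (by linarith)).2⟩
  exact ((integrableOn_exp_mul_Ioi (a := -(1 / 2)) (by norm_num) 0).const_mul _).lintegral_lt_top

/-- The maximal estimate for the regularized evolution of an integrable function. -/
theorem lintegral_iSup_eN_le [Nontrivial (Eucl n)] [SFinite μ] (hα : 0 < α) (hF : Integrable F)
    (h : ∀ φ : Eucl n → ℝ, Measurable φ → ∫⁻ x, schrodingerMax n α (modulate φ F) x ∂μ ≤ A) :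
    (∫⁻ x, (⨆ (t : ℝ) (_ : t ∈ Ioo (0 : ℝ) 1) (N : ℝ) (_ : 1 ≤ N),
      ENNReal.ofReal ‖eN n α N F x t‖) ∂μ) ≤ cutoffConst α * A := by
  have hb : 0 < 2 * α := by linarith
  refine (lintegral_mono fun x => iSup₂_le fun t ht => iSup₂_le fun N hN =>
    (ofReal_norm _).le.trans (enorm_eN_le α hα hF hN ht x)).trans ?_
  have hm := measurable_schrodingerLongMax α hF
  rw [lintegral_add_left (hm.const_mul _), lintegral_const_mul _ hm, cutoffConst, add_mul,
    mul_assoc]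
  gcongr
  · exact lintegral_schrodingerLongMax_le α hF h
  · exact lintegral_schrodingerImagMax_le α hF (integrable_fourier_logProfile hb) h

theorem integrable_gauss_mul (hF : Integrable F) (N : ℝ) :
    Integrable fun ξ => (Real.exp (-(‖ξ‖ / N) ^ 2) : ℂ) * F ξ := by
  refine hF.bdd_mul (c := 1) (by fun_prop) (Eventually.of_forall fun ξ => ?_)
  rw [Complex.norm_real, Real.norm_eq_abs, Real.abs_exp]
  exact Real.exp_le_one_iff.2 (neg_nonpos.2 (sq_nonneg _))

theorem measurable_iSup_eN (hF : Integrable F) :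
    Measurable fun x => ⨆ (t : ℝ) (_ : t ∈ Ioo (0 : ℝ) 1) (N : ℝ) (_ : 1 ≤ N),
      ENNReal.ofReal ‖eN n α N F x t‖ := by
  simp only [eN_eq_schrodingerOp]
  exact LowerSemicontinuous.measurable (lowerSemicontinuous_biSup fun t _ =>
    lowerSemicontinuous_biSup fun N _ => (ENNReal.continuous_ofReal.comp
      (continuous_schrodingerOp_left α (integrable_gauss_mul hF N) t).norm).lowerSemicontinuous)

end evolution

section truncation

variable {n : ℕ} {s : ℝ} {F : Eucl n → ℂ}

theorem integrable_norm_sq_of_memHs (hs : 0 ≤ s) (hF : MemHs n s F) :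
    Integrable fun ξ => ‖F ξ‖ ^ 2 := by
  refine hF.2.mono' (hF.1.norm.pow 2) (Eventually.of_forall fun ξ => ?_)
  rw [Real.norm_eq_abs, abs_of_nonneg (by positivity)]
  exact le_mul_of_one_le_left (by positivity)
    (Real.one_le_rpow (le_add_of_nonneg_right (by positivity)) hs)

theorem memHs_indicator (hF : MemHs n s F) {S : Set (Eucl n)} (hS : MeasurableSet S) :
    MemHs n s (S.indicator F) := by
  refine ⟨hF.1.indicator hS, (hF.2.indicator hS).congr (Eventually.of_forall fun ξ => ?_)⟩
  by_cases h : ξ ∈ S <;> simp [h]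

theorem sobolevNormSq_indicator_le (hF : MemHs n s F) {S : Set (Eucl n)} (hS : MeasurableSet S) :
    sobolevNormSq n s (S.indicator F) ≤ sobolevNormSq n s F := by
  refine integral_mono (memHs_indicator hF hS).2 hF.2 fun ξ => ?_
  refine mul_le_mul_of_nonneg_left ?_ (by positivity)
  gcongr
  exact norm_indicator_le_norm_self F ξ

theorem integrable_indicator_ball_of_memHs (hs : 0 ≤ s) (hF : MemHs n s F) (R : ℝ) :
    Integrable ((ball 0 R).indicator F) := by
  rw [integrable_indicator_iff measurableSet_ball]
  have h1 : IntegrableOn (fun _ : Eucl n => (1 : ℝ)) (ball 0 R) :=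
    integrableOn_const measure_ball_lt_top.ne
  refine (h1.add (integrable_norm_sq_of_memHs hs hF).integrableOn).mono' hF.1.restrict
    (Eventually.of_forall fun ξ => ?_)
  simp only [Pi.add_apply]
  nlinarith [sq_nonneg (‖F ξ‖ - 1), norm_nonneg (F ξ)]

theorem tendsto_eN_indicator_ball (α : ℝ) (hs : 0 ≤ s) (hF : MemHs n s F) {N : ℝ} (hN : 0 < N)
    (x : Eucl n) (t : ℝ) :
    Tendsto (fun k : ℕ => eN n α N ((ball 0 (k : ℝ)).indicator F) x t) atTop
      (𝓝 (eN n α N F x t)) := by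
  have hg : Integrable fun ξ : Eucl n => Real.exp (-(2 / N ^ 2) * ‖ξ‖ ^ 2) := by
    have := (GaussianFourier.integrable_cexp_neg_mul_sq_norm_add
      (b := ((2 / N ^ 2 : ℝ) : ℂ)) (by rw [Complex.ofReal_re]; positivity) 0 (0 : Eucl n)).norm
    refine this.congr (Eventually.of_forall fun ξ => ?_)
    simp only [Complex.norm_exp]
    congr 1
    simp [← Complex.ofReal_pow]
  simp only [eN]
  refine Tendsto.const_smul (tendsto_integral_of_dominated_convergence
    (fun ξ => Real.exp (-(2 / N ^ 2) * ‖ξ‖ ^ 2) + ‖F ξ‖ ^ 2) (fun k => ?_)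
    (hg.add (integrable_norm_sq_of_memHs hs hF)) (fun k => Eventually.of_forall fun ξ => ?_)
    (Eventually.of_forall fun ξ => ?_)) _
  · have := hF.1.indicator (measurableSet_ball (x := (0 : Eucl n)) (ε := (k : ℝ)))
    have h1 : Measurable fun ξ : Eucl n => Real.exp (-(‖ξ‖ / N) ^ 2) := by fun_prop
    have h2 : Measurable fun ξ : Eucl n =>
        Complex.exp (Complex.I * ((⟪x, ξ⟫ + t * ‖ξ‖ ^ (2 * α) : ℝ) : ℂ)) := by fun_prop
    exact h1.aestronglyMeasurable.smul (h2.aestronglyMeasurable.mul this)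
  · rw [norm_smul, norm_mul, norm_exp_I_mul, one_mul, Real.norm_eq_abs, Real.abs_exp]
    have e : Real.exp (-(2 / N ^ 2) * ‖ξ‖ ^ 2) = Real.exp (-(‖ξ‖ / N) ^ 2) ^ 2 := by
      rw [← Real.exp_nat_mul]
      congr 1; push_cast; field_simp
    rw [e]
    have h1 := norm_indicator_le_norm_self (s := ball 0 (k : ℝ)) F ξ
    have h2 := Real.exp_pos (-(‖ξ‖ / N) ^ 2)
    refine (mul_le_mul_of_nonneg_left h1 h2.le).trans ?_
    nlinarith [sq_nonneg (Real.exp (-(‖ξ‖ / N) ^ 2) - ‖F ξ‖),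
      sq_nonneg (Real.exp (-(‖ξ‖ / N) ^ 2)), sq_nonneg ‖F ξ‖]
  · refine tendsto_const_nhds.congr' ?_
    obtain ⟨k₀, hk₀⟩ := exists_nat_gt ‖ξ‖
    filter_upwards [eventually_ge_atTop k₀] with k hk
    have : ξ ∈ ball (0 : Eucl n) k := by
      rw [mem_ball_zero_iff]
      exact hk₀.trans_le (by exact_mod_cast hk)
    rw [indicator_of_mem this]

theorem iSup_eN_le_liminf (α : ℝ) (hs : 0 ≤ s) (hF : MemHs n s F) (x : Eucl n) :
    (⨆ (t : ℝ) (_ : t ∈ Ioo (0 : ℝ) 1) (N : ℝ) (_ : 1 ≤ N), ENNReal.ofReal ‖eN n α N F x t‖) ≤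
      liminf (fun k : ℕ => ⨆ (t : ℝ) (_ : t ∈ Ioo (0 : ℝ) 1) (N : ℝ) (_ : 1 ≤ N),
        ENNReal.ofReal ‖eN n α N ((ball 0 (k : ℝ)).indicator F) x t‖) atTop := by
  refine iSup₂_le fun t ht => iSup₂_le fun N hN => ?_
  have h := (ENNReal.continuous_ofReal.tendsto _).comp
    (tendsto_eN_indicator_ball α hs hF (zero_lt_one.trans_le hN) x t).norm
  rw [← h.liminf_eq]
  refine liminf_le_liminf (Eventually.of_forall fun k => ?_)
  exact le_iSup₂_of_le t ht (le_iSup₂_of_le N hN le_rfl)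

end truncation

/-- if the maximal estimate for `sup_{0<t<1}|e^{it(-Δ)^α}f|` holds for a
fixed `μ ∈ M^κ(𝔹ⁿ)`, then the double-maximal estimate
`‖sup_{0<t<1} sup_{N≥1} |e_N^{it(-Δ)^α}f|‖_{L¹(μ)} ≲ √C_κ(μ) ‖f‖_{H^s}` holds. -/
theorem statement3 (n : ℕ) (α s κ : ℝ) (hα : 1 / 2 < α)
    (hs₀ : 0 < s) (hs : s ≤ (n : ℝ) / 2) (hκ : (n : ℝ) - 2 * s < κ)
    (μ : Measure (Eucl n)) (hprob : IsProbabilityMeasure μ)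
    (hsupp : μ (ball (0 : Eucl n) 1)ᶜ = 0) (hCκ : Ckappa n κ μ < ⊤)
    (H : ∃ C > (0 : ℝ), ∀ Ff : Eucl n → ℂ, MemHs n s Ff →
      (∫⁻ x, (⨆ (t : ℝ) (_ : t ∈ Ioo (0 : ℝ) 1),
          ENNReal.ofReal ‖schrodingerOp n α Ff x t‖) ∂μ)
        ≤ ENNReal.ofReal C * (Ckappa n κ μ) ^ (1 / 2 : ℝ) *
            ENNReal.ofReal ((sobolevNormSq n s Ff) ^ (1 / 2 : ℝ))) :
    ∃ C > (0 : ℝ), ∀ Ff : Eucl n → ℂ, MemHs n s Ff →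
      (∫⁻ x, (⨆ (t : ℝ) (_ : t ∈ Ioo (0 : ℝ) 1) (N : ℝ) (_ : 1 ≤ N),
          ENNReal.ofReal ‖eN n α N Ff x t‖) ∂μ)
        ≤ ENNReal.ofReal C * (Ckappa n κ μ) ^ (1 / 2 : ℝ) *
            ENNReal.ofReal ((sobolevNormSq n s Ff) ^ (1 / 2 : ℝ)) := by
  obtain ⟨C, hC, H⟩ := H
  have hα₀ : 0 < α := by linarith
  have hn : n ≠ 0 := by
    rintro rfl
    norm_num at hs
    linarith
  have : Nonempty (Fin n) := ⟨⟨0, Nat.pos_of_ne_zero hn⟩⟩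
  have hK := cutoffConst_lt_top α hα₀
  refine ⟨((cutoffConst α).toReal + 1) * C, by positivity, fun F hF => ?_⟩
  set A : ℝ≥0∞ := ENNReal.ofReal C * Ckappa n κ μ ^ (1 / 2 : ℝ) *
    ENNReal.ofReal (sobolevNormSq n s F ^ (1 / 2 : ℝ)) with hA
  have trunc (k : ℕ) : (∫⁻ x, (⨆ (t : ℝ) (_ : t ∈ Ioo (0 : ℝ) 1) (N : ℝ) (_ : 1 ≤ N),
      ENNReal.ofReal ‖eN n α N ((ball 0 (k : ℝ)).indicator F) x t‖) ∂μ) ≤ cutoffConst α * A := by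
    refine lintegral_iSup_eN_le α hα₀ (integrable_indicator_ball_of_memHs hs₀.le hF k)
      fun φ hφ => ?_
    have hFk := memHs_indicator hF (measurableSet_ball (x := (0 : Eucl n)) (ε := (k : ℝ)))
    refine (H _ (memHs_modulate hφ hFk)).trans ?_
    rw [hA, sobolevNormSq_modulate]
    gcongr
    · exact integral_nonneg fun ξ => by positivity
    · exact sobolevNormSq_indicator_le hF measurableSet_ball
  have hle : (∫⁻ x, (⨆ (t : ℝ) (_ : t ∈ Ioo (0 : ℝ) 1) (N : ℝ) (_ : 1 ≤ N),
      ENNReal.ofReal ‖eN n α N F x t‖) ∂μ) ≤ cutoffConst α * A :=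
    calc _ ≤ _ := lintegral_mono (iSup_eN_le_liminf α hs₀.le hF)
      _ ≤ _ := lintegral_liminf_le fun k =>
        measurable_iSup_eN α (integrable_indicator_ball_of_memHs hs₀.le hF k)
      _ ≤ _ := (liminf_le_liminf (Eventually.of_forall trunc)).trans_eq (liminf_const _)
  refine hle.trans ?_
  rw [hA, ← mul_assoc, ← mul_assoc, ENNReal.ofReal_mul (by positivity)]
  gcongr
  exact (ENNReal.le_ofReal_iff_toReal_le hK.ne (by positivity)).2 (by linarith)
end
end
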